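/- Let n ≥ 1, let ν be an even log-concave measure on ℝⁿ, i.e. a measure with density e^{−V} with respect to Lebesgue measure where V : ℝⁿ → ℝ ∪ {+∞} is even and convex, and let ℰ ⊆ ℝⁿ be an ellipsoid, i.e. the image of the closed Euclidean unit ball under an invertible linear map. Then the function t ↦ ν(e^t ℰ) is log-concave on ℝ. -/

import Mathlib

open MeasureTheory Set
open scoped ENNReal Pointwise

namespace BallLogConcave

open scoped ContDiff Topology Convolution
open Filter

/-- Euclidean space of dimension `n`. -/
abbrev Euc (n : ℕ) := EuclideanSpace ℝ (Fin n)

variable {n : ℕ}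

/-- The `i`-th partial derivative. -/
noncomputable def pd (i : Fin n) (f : Euc n → ℝ) (x : Euc n) : ℝ :=
  fderiv ℝ f x (EuclideanSpace.single i 1)

lemma differentiable_of_smooth {f : Euc n → ℝ} (hf : ContDiff ℝ ∞ f) : Differentiable ℝ f :=
  hf.differentiable (by simp)

lemma contDiff_pd {f : Euc n → ℝ} (hf : ContDiff ℝ ∞ f) (i : Fin n) : ContDiff ℝ ∞ (pd i f) :=
  (hf.fderiv_right (m := ∞) (by simp)).clm_apply contDiff_const

lemma hasCompactSupport_pd {f : Euc n → ℝ} (hf : HasCompactSupport f) (i : Fin n) :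
    HasCompactSupport (pd i f) :=
  hf.fderiv_apply (𝕜 := ℝ) _

lemma pd_add {f g : Euc n → ℝ} (hf : ContDiff ℝ ∞ f) (hg : ContDiff ℝ ∞ g) (i : Fin n)
    (x : Euc n) : pd i (fun x => f x + g x) x = pd i f x + pd i g x := by
  unfold pd
  rw [fderiv_fun_add (differentiable_of_smooth hf x) (differentiable_of_smooth hg x)]
  rfl

lemma pd_mul {f g : Euc n → ℝ} (hf : ContDiff ℝ ∞ f) (hg : ContDiff ℝ ∞ g) (i : Fin n)
    (x : Euc n) : pd i (fun x => f x * g x) x = f x * pd i g x + pd i f x * g x := by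
  unfold pd
  rw [fderiv_fun_mul (differentiable_of_smooth hf x) (differentiable_of_smooth hg x)]
  simp [mul_comm]

lemma pd_const_mul {f : Euc n → ℝ} (hf : ContDiff ℝ ∞ f) (c : ℝ) (i : Fin n)
    (x : Euc n) : pd i (fun x => c * f x) x = c * pd i f x := by
  unfold pd
  rw [fderiv_const_mul (differentiable_of_smooth hf x)]
  rfl

lemma pd_sum {ι : Type*} (s : Finset ι) {f : ι → Euc n → ℝ} (hf : ∀ j, ContDiff ℝ ∞ (f j))
    (i : Fin n) (x : Euc n) :
    pd i (fun x => ∑ j ∈ s, f j x) x = ∑ j ∈ s, pd i (f j) x := by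
  unfold pd
  rw [fderiv_fun_sum (fun j _ => differentiable_of_smooth (hf j) x)]
  simp

lemma pd_comm {f : Euc n → ℝ} (hf : ContDiff ℝ ∞ f) (i j : Fin n) (x : Euc n) :
    pd i (pd j f) x = pd j (pd i f) x := by
  have h : IsSymmSndFDerivAt ℝ f x :=
    hf.contDiffAt.isSymmSndFDerivAt (by
      simp only [minSmoothness_of_isRCLikeNormedField]
      exact WithTop.coe_le_coe.2 (le_top (a := (2 : ℕ∞))))
  have hd : DifferentiableAt ℝ (fderiv ℝ f) x :=
    (hf.fderiv_right (m := ∞) (by simp)).differentiable (by simp) x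
  have key : ∀ k l : Fin n, pd k (pd l f) x =
      fderiv ℝ (fderiv ℝ f) x (EuclideanSpace.single k 1) (EuclideanSpace.single l 1) := by
    intro k l
    unfold pd
    rw [fderiv_clm_apply hd (differentiableAt_const _)]
    simp
  rw [key, key]
  exact h _ _

lemma pd_comp_neg {f : Euc n → ℝ} (hf : ContDiff ℝ ∞ f) (i : Fin n) (x : Euc n) :
    pd i (fun x => f (-x)) x = - pd i f (-x) := by
  have h : HasFDerivAt (fun x => f (-x)) _ x :=
    (differentiable_of_smooth hf (-x)).hasFDerivAt.comp x (hasFDerivAt_id x).neg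
  unfold pd
  rw [h.fderiv]
  simp

lemma integrable_of_compact {f : Euc n → ℝ} (hf : Continuous f) (hc : HasCompactSupport f) :
    Integrable f :=
  hf.integrable_of_hasCompactSupport hc

lemma integral_pd_mul {f g : Euc n → ℝ} (hf : ContDiff ℝ ∞ f) (hg : ContDiff ℝ ∞ g)
    (hc : HasCompactSupport g) (i : Fin n) :
    ∫ x, pd i f x * g x = - ∫ x, f x * pd i g x := by
  have := integral_mul_fderiv_eq_neg_fderiv_mul_of_integrable (μ := (volume : Measure (Euc n)))
    (f := f) (g := g) (v := EuclideanSpace.single i 1)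
    (integrable_of_compact ((contDiff_pd hf i).continuous.mul hg.continuous) hc.mul_left)
    (integrable_of_compact (hf.continuous.mul (contDiff_pd hg i).continuous)
      (hasCompactSupport_pd hc i).mul_left)
    (integrable_of_compact (hf.continuous.mul hg.continuous) hc.mul_left)
    (fun x _ => differentiable_of_smooth hf x) (fun x _ => differentiable_of_smooth hg x)
  unfold pd
  rw [this, neg_neg]

/-- The generator `Δ - ∇U · ∇` of the measure with density `exp (-U)`. -/
noncomputable def gen (U u : Euc n → ℝ) (x : Euc n) : ℝ :=
  ∑ i, (pd i (pd i u) x - pd i U x * pd i u x)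

lemma contDiff_gen {U u : Euc n → ℝ} (hU : ContDiff ℝ ∞ U) (hu : ContDiff ℝ ∞ u) :
    ContDiff ℝ ∞ (gen U u) :=
  ContDiff.sum fun i _ => (contDiff_pd (contDiff_pd hu i) i).sub
    ((contDiff_pd hU i).mul (contDiff_pd hu i))

lemma hasCompactSupport_sum {ι : Type*} (s : Finset ι) {f : ι → Euc n → ℝ}
    (hf : ∀ j, HasCompactSupport (f j)) : HasCompactSupport (fun x => ∑ j ∈ s, f j x) := by
  classical
  induction s using Finset.induction_on with
  | empty =>
    simp only [Finset.sum_empty]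
    exact (HasCompactSupport.zero : HasCompactSupport (0 : Euc n → ℝ))
  | insert a s ha ih =>
    simp only [Finset.sum_insert ha]
    exact (hf a).add ih

lemma hasCompactSupport_gen (U : Euc n → ℝ) {u : Euc n → ℝ} (hu : HasCompactSupport u) :
    HasCompactSupport (gen U u) :=
  hasCompactSupport_sum _ fun i =>
    (hasCompactSupport_pd (hasCompactSupport_pd hu i) i).sub (hasCompactSupport_pd hu i).mul_left

lemma contDiff_density {U : Euc n → ℝ} (hU : ContDiff ℝ ∞ U) :
    ContDiff ℝ ∞ (fun x => Real.exp (-U x)) :=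
  hU.neg.exp

lemma pd_density {U : Euc n → ℝ} (hU : ContDiff ℝ ∞ U) (i : Fin n) (x : Euc n) :
    pd i (fun x => Real.exp (-U x)) x = - (pd i U x * Real.exp (-U x)) := by
  unfold pd
  have h : HasFDerivAt (fun x => Real.exp (-U x)) _ x :=
    (differentiable_of_smooth hU x).hasFDerivAt.fun_neg.exp
  rw [h.fderiv]
  simp [mul_comm]

/-- Integration by parts for the generator. -/
lemma integral_mul_gen {U u φ : Euc n → ℝ} (hU : ContDiff ℝ ∞ U) (hu : ContDiff ℝ ∞ u)
    (hc : HasCompactSupport u) (hφ : ContDiff ℝ ∞ φ) :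
    ∫ x, (φ x * gen U u x + ∑ i, pd i φ x * pd i u x) * Real.exp (-U x) = 0 := by
  have hρ := contDiff_density hU
  have key : ∀ i : Fin n,
      ∫ x, (φ x * (pd i (pd i u) x - pd i U x * pd i u x) + pd i φ x * pd i u x)
        * Real.exp (-U x) = 0 := by
    intro i
    have hg : ContDiff ℝ ∞ (fun x => pd i u x * Real.exp (-U x)) := (contDiff_pd hu i).mul hρ
    have hgc : HasCompactSupport (fun x => pd i u x * Real.exp (-U x)) :=
      (hasCompactSupport_pd hc i).mul_right
    have h := integral_pd_mul hφ hg hgc i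
    have i1 : Integrable (fun x => pd i φ x * (pd i u x * Real.exp (-U x))) :=
      integrable_of_compact ((contDiff_pd hφ i).continuous.mul hg.continuous) hgc.mul_left
    have i2 : Integrable (fun x => φ x * pd i (fun x => pd i u x * Real.exp (-U x)) x) :=
      integrable_of_compact (hφ.continuous.mul (contDiff_pd hg i).continuous)
        (hasCompactSupport_pd hgc i).mul_left
    have h2 : ∫ x, (pd i φ x * (pd i u x * Real.exp (-U x))
        + φ x * pd i (fun x => pd i u x * Real.exp (-U x)) x) = 0 := by
      rw [integral_add i1 i2, h]; ring
    rw [← h2]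
    congr 1
    ext x
    rw [pd_mul (contDiff_pd hu i) hρ, pd_density hU]
    ring
  have e : ∀ x, (φ x * gen U u x + ∑ i, pd i φ x * pd i u x) * Real.exp (-U x) =
      ∑ i, (φ x * (pd i (pd i u) x - pd i U x * pd i u x) + pd i φ x * pd i u x)
        * Real.exp (-U x) := by
    intro x
    rw [← Finset.sum_mul, Finset.sum_add_distrib, gen, Finset.mul_sum]
  simp_rw [e]
  rw [integral_finsetSum]
  · simp [key]
  · intro i _
    refine integrable_of_compact ?_ ?_
    · exact (((hφ.mul ((contDiff_pd (contDiff_pd hu i) i).sub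
        ((contDiff_pd hU i).mul (contDiff_pd hu i)))).add
        ((contDiff_pd hφ i).mul (contDiff_pd hu i))).mul hρ).continuous
    · exact ((((hasCompactSupport_pd (hasCompactSupport_pd hc i) i).sub
        (hasCompactSupport_pd hc i).mul_left).mul_left).add
        (hasCompactSupport_pd hc i).mul_left).mul_right

lemma pd_gen {U u : Euc n → ℝ} (hU : ContDiff ℝ ∞ U) (hu : ContDiff ℝ ∞ u) (j : Fin n)
    (x : Euc n) :
    pd j (gen U u) x = gen U (pd j u) x - ∑ i, pd i (pd j U) x * pd i u x := by
  have h : ∀ i : Fin n, ContDiff ℝ ∞ (fun x => pd i (pd i u) x + -1 * (pd i U x * pd i u x)) :=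
    fun i => (contDiff_pd (contDiff_pd hu i) i).add
      (contDiff_const.mul ((contDiff_pd hU i).mul (contDiff_pd hu i)))
  have e : gen U u = fun x => ∑ i, (pd i (pd i u) x + -1 * (pd i U x * pd i u x)) := by
    ext x; simp [gen, sub_eq_add_neg]
  rw [e, pd_sum _ h, gen, ← Finset.sum_sub_distrib]
  refine Finset.sum_congr rfl fun i _ => ?_
  rw [pd_add (contDiff_pd (contDiff_pd hu i) i)
    (contDiff_const.mul ((contDiff_pd hU i).mul (contDiff_pd hu i))),
    pd_const_mul ((contDiff_pd hU i).mul (contDiff_pd hu i)),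
    pd_mul (contDiff_pd hU i) (contDiff_pd hu i), pd_comm (contDiff_pd hu i) j i,
    pd_comm hU j i, pd_comm hu j i]
  have : (fun x => pd j (pd i u) x) = fun x => pd i (pd j u) x := by
    ext x; exact pd_comm hu j i x
  rw [show pd j (pd i u) = pd i (pd j u) from this]
  ring

/-- The weighted Bochner identity. -/
lemma bochner {U u ζ : Euc n → ℝ} (hU : ContDiff ℝ ∞ U) (hu : ContDiff ℝ ∞ u)
    (hc : HasCompactSupport u) (hζ : ContDiff ℝ ∞ ζ) :
    ∫ x, (ζ x * gen U u x ^ 2 + 2 * gen U u x * (∑ i, pd i ζ x * pd i u x)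
      - ζ x * (∑ i, ∑ j, pd i (pd j u) x ^ 2)
      - ζ x * (∑ i, ∑ j, pd i (pd j U) x * pd i u x * pd j u x)
      + ∑ i, ∑ j, pd i (pd j ζ) x * pd i u x * pd j u x) * Real.exp (-U x) = 0 := by
  have hρ := contDiff_density hU
  have hL := contDiff_gen hU hu
  have hs : ContDiff ℝ ∞ (fun x => ∑ i, pd i ζ x * pd i u x) :=
    ContDiff.sum fun i _ => (contDiff_pd hζ i).mul (contDiff_pd hu i)
  have a := integral_mul_gen hU hu hc (hζ.mul hL)
  have d := integral_mul_gen hU hu hc hs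
  have cc := fun j => integral_mul_gen hU (contDiff_pd hu j) (hasCompactSupport_pd hc j)
    (hζ.mul (contDiff_pd hu j))
  have integ : ∀ {φ v : Euc n → ℝ}, ContDiff ℝ ∞ φ → ContDiff ℝ ∞ v → HasCompactSupport v →
      Integrable (fun x => (φ x * gen U v x + ∑ i, pd i φ x * pd i v x) * Real.exp (-U x)) := by
    intro φ v hφ hv hvc
    refine integrable_of_compact ?_ ?_
    · exact (((hφ.mul (contDiff_gen hU hv)).add (ContDiff.sum fun i _ =>
        (contDiff_pd hφ i).mul (contDiff_pd hv i))).mul hρ).continuous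
    · exact ((hasCompactSupport_gen U hvc).mul_left.add (hasCompactSupport_sum _ fun i =>
        (hasCompactSupport_pd hvc i).mul_left)).mul_right
  have ia := integ (hζ.mul hL) hu hc
  have id' := integ hs hu hc
  have ic := fun j => integ (hζ.mul (contDiff_pd hu j)) (contDiff_pd hu j)
    (hasCompactSupport_pd hc j)
  have tot : ∫ x, (((ζ x * gen U u x * gen U u x
      + ∑ i, pd i (fun x => ζ x * gen U u x) x * pd i u x) * Real.exp (-U x)
      + ((∑ i, pd i ζ x * pd i u x) * gen U u x
        + ∑ i, pd i (fun x => ∑ i, pd i ζ x * pd i u x) x * pd i u x) * Real.exp (-U x))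
      - ∑ j, (ζ x * pd j u x * gen U (pd j u) x
        + ∑ i, pd i (fun x => ζ x * pd j u x) x * pd i (pd j u) x) * Real.exp (-U x)) = 0 := by
    refine (integral_sub (ia.add id') (integrable_finsetSum _ fun j _ => ic j)).trans ?_
    rw [integral_add' ia id', integral_finsetSum _ fun j _ => ic j, a, d,
      Finset.sum_eq_zero fun j _ => cc j]
    simp
  rw [← tot]
  congr 1
  ext x
  have e1 : ∑ i, pd i (fun x => ζ x * gen U u x) x * pd i u x =
      ζ x * (∑ j, pd j u x * gen U (pd j u) x)
        - ζ x * (∑ i, ∑ j, pd i (pd j U) x * pd i u x * pd j u x)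
        + gen U u x * ∑ i, pd i ζ x * pd i u x := by
    rw [Finset.sum_comm, Finset.mul_sum, Finset.mul_sum, Finset.mul_sum,
      ← Finset.sum_sub_distrib, ← Finset.sum_add_distrib]
    refine Finset.sum_congr rfl fun j _ => ?_
    rw [pd_mul hζ hL, pd_gen hU hu, ← Finset.sum_mul]
    ring
  have e2 : ∑ i, pd i (fun x => ∑ i, pd i ζ x * pd i u x) x * pd i u x =
      (∑ i, ∑ j, pd i (pd j ζ) x * pd i u x * pd j u x)
        + ∑ j, ∑ i, pd i ζ x * pd j u x * pd i (pd j u) x := by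
    rw [Finset.sum_comm, ← Finset.sum_add_distrib]
    refine (Finset.sum_congr rfl fun i _ => ?_)
    rw [pd_sum _ (fun k => (contDiff_pd hζ k).mul (contDiff_pd hu k)), Finset.sum_mul,
      ← Finset.sum_add_distrib]
    refine Finset.sum_congr rfl fun k _ => ?_
    rw [pd_mul (contDiff_pd hζ k) (contDiff_pd hu k), pd_comm hζ i k, pd_comm hu i k]
    ring
  have e3 : ∑ j, (ζ x * pd j u x * gen U (pd j u) x
        + ∑ i, pd i (fun x => ζ x * pd j u x) x * pd i (pd j u) x) * Real.exp (-U x) =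
      (ζ x * (∑ j, pd j u x * gen U (pd j u) x) + ζ x * (∑ i, ∑ j, pd i (pd j u) x ^ 2)
        + ∑ j, ∑ i, pd i ζ x * pd j u x * pd i (pd j u) x) * Real.exp (-U x) := by
    rw [← Finset.sum_mul]
    congr 1
    rw [Finset.sum_comm (f := fun i j => pd i (pd j u) x ^ 2), Finset.mul_sum, Finset.mul_sum,
      ← Finset.sum_add_distrib, ← Finset.sum_add_distrib]
    refine Finset.sum_congr rfl fun j _ => ?_
    rw [Finset.mul_sum, add_assoc, ← Finset.sum_add_distrib]
    congr 1
    · ring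
    refine Finset.sum_congr rfl fun i _ => ?_
    rw [pd_mul hζ (contDiff_pd hu j)]
    ring
  rw [e1, e2, e3]
  ring

/-- A sequence of bump functions concentrating at the origin. -/
noncomputable def bump (n k : ℕ) : ContDiffBump (0 : Euc n) where
  rIn := 1 / (2 * ((k : ℝ) + 1))
  rOut := 1 / ((k : ℝ) + 1)
  rIn_pos := by positivity
  rIn_lt_rOut := by
    apply one_div_lt_one_div_of_lt (by positivity)
    have : (0 : ℝ) < (k : ℝ) + 1 := by positivity
    linarith

/-- A sequence of even mollifiers. -/
noncomputable def moll (n k : ℕ) : Euc n → ℝ := (bump n k).normed volume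

lemma moll_nonneg (k : ℕ) (x : Euc n) : 0 ≤ moll n k x := (bump n k).nonneg_normed x

lemma moll_neg (k : ℕ) (x : Euc n) : moll n k (-x) = moll n k x := (bump n k).normed_neg x

lemma moll_sub_comm (k : ℕ) (x t : Euc n) : moll n k (x - t) = moll n k (t - x) := by
  rw [← moll_neg, neg_sub]

lemma contDiff_moll (k : ℕ) : ContDiff ℝ ∞ (moll n k) := (bump n k).contDiff_normed

lemma hasCompactSupport_moll (k : ℕ) : HasCompactSupport (moll n k) :=
  (bump n k).hasCompactSupport_normed

lemma integral_moll (n k : ℕ) : ∫ x, moll n k x = 1 := (bump n k).integral_normed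

lemma integrable_moll (n k : ℕ) : Integrable (moll n k) := (bump n k).integrable_normed

lemma moll_eq_zero {k : ℕ} {x : Euc n} (hx : 1 / ((k : ℝ) + 1) ≤ ‖x‖) : moll n k x = 0 := by
  have h : x ∉ Function.support (moll n k) := by
    unfold moll
    rw [(bump n k).support_normed_eq]
    simpa [bump] using hx
  simpa using h

lemma integral_moll_sub (k : ℕ) (x : Euc n) : ∫ t, moll n k (x - t) = 1 := by
  rw [integral_sub_left_eq_self (fun t => moll n k t), integral_moll]

lemma tendsto_bump_rOut (n : ℕ) : Tendsto (fun k => (bump n k).rOut) atTop (𝓝 0) :=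
  tendsto_one_div_add_atTop_nhds_zero_nat

/-- Convolution of `p` with the kernel `φ`. -/
noncomputable def conv (φ p : Euc n → ℝ) : Euc n → ℝ :=
  p ⋆[ContinuousLinearMap.mul ℝ ℝ, volume] φ

lemma conv_apply (φ p : Euc n → ℝ) (x : Euc n) : conv φ p x = ∫ t, p t * φ (x - t) := rfl

lemma contDiff_conv {φ p : Euc n → ℝ} (hp : LocallyIntegrable p) (hφ : ContDiff ℝ ∞ φ)
    (hc : HasCompactSupport φ) : ContDiff ℝ ∞ (conv φ p) :=
  hc.contDiff_convolution_right _ hp hφ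

lemma pd_conv {φ p : Euc n → ℝ} (hp : LocallyIntegrable p) (hφ : ContDiff ℝ ∞ φ)
    (hc : HasCompactSupport φ) (i : Fin n) (x : Euc n) :
    pd i (conv φ p) x = conv (pd i φ) p x := by
  have hφ1 : ContDiff ℝ 1 φ := hφ.of_le (by exact_mod_cast le_top)
  have h := hc.hasFDerivAt_convolution_right (ContinuousLinearMap.mul ℝ ℝ) hp hφ1 x
  unfold pd conv
  rw [h.fderiv, convolution_precompR_apply _ hp (hc.fderiv ℝ)
    (hφ1.continuous_fderiv one_ne_zero)]

lemma integrable_conv_integrand {φ p : Euc n → ℝ} (hp : LocallyIntegrable p) (hφ : Continuous φ)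
    (hc : HasCompactSupport φ) (x : Euc n) : Integrable fun t => p t * φ (x - t) :=
  hc.convolutionExists_right (ContinuousLinearMap.mul ℝ ℝ) hp hφ x

lemma ae_tendsto_conv {p : Euc n → ℝ} (hp : LocallyIntegrable p) :
    ∀ᵐ x, Tendsto (fun k => conv (moll n k) p x) atTop (𝓝 (p x)) := by
  filter_upwards [ContDiffBump.ae_convolution_tendsto_right_of_locallyIntegrable (μ := volume)
    (K := 2) (tendsto_bump_rOut n) (Eventually.of_forall fun k => by
      simp only [bump]; field_simp; rfl) hp] with x hx
  refine hx.congr fun k => ?_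
  rw [convolution_eq_swap, conv_apply]
  refine integral_congr_ae (Eventually.of_forall fun t => ?_)
  simp [moll, mul_comm]

lemma tendsto_conv_of_continuous {w : Euc n → ℝ} (hw : Continuous w) (x : Euc n) :
    Tendsto (fun k => conv (moll n k) w x) atTop (𝓝 (w x)) := by
  refine (ContDiffBump.convolution_tendsto_right_of_continuous (μ := volume)
    (tendsto_bump_rOut n) hw x).congr fun k => ?_
  rw [convolution_eq_swap, conv_apply]
  refine integral_congr_ae (Eventually.of_forall fun t => ?_)
  simp [moll, mul_comm]

lemma integral_conv_mul {p w : Euc n → ℝ} (hp : LocallyIntegrable p) (hw : Continuous w)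
    (hwc : HasCompactSupport w) (k : ℕ) :
    ∫ x, conv (moll n k) p x * w x = ∫ t, p t * conv (moll n k) w t := by
  set K : Set (Euc n) :=
    (fun z : Euc n × Euc n => z.1 - z.2) '' (tsupport w ×ˢ tsupport (moll n k))
  have hKc : IsCompact K :=
    (hwc.isCompact.prod (hasCompactSupport_moll k).isCompact).image
      (continuous_fst.sub continuous_snd)
  have hq : Integrable (K.indicator p) :=
    (hp.integrableOn_isCompact hKc).integrable_indicator hKc.measurableSet
  have hwi : Integrable w := integrable_of_compact hw hwc
  obtain ⟨C, hC⟩ := (hasCompactSupport_moll (n := n) k).exists_bound_of_continuous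
    (contDiff_moll k).continuous
  have hi : Integrable (fun z : Euc n × Euc n => p z.2 * moll n k (z.1 - z.2) * w z.1)
      (volume.prod volume) := by
    have h1 : Integrable (fun z : Euc n × Euc n => moll n k (z.1 - z.2) *
        (w z.1 * K.indicator p z.2)) (volume.prod volume) := by
      refine (hwi.mul_prod hq).bdd_mul (c := C) ?_ (Eventually.of_forall fun z => hC _)
      exact ((contDiff_moll k).continuous.comp
        (continuous_fst.sub continuous_snd)).aestronglyMeasurable
    refine h1.congr (Eventually.of_forall fun z => ?_)
    simp only
    by_cases hz : z.2 ∈ K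
    · rw [indicator_of_mem hz]; ring
    · have : w z.1 = 0 ∨ moll n k (z.1 - z.2) = 0 := by
        by_contra! hcon
        refine hz ⟨(z.1, z.1 - z.2),
          ⟨subset_tsupport _ hcon.1, subset_tsupport _ hcon.2⟩, ?_⟩
        simp
      rcases this with h | h <;> simp [h]
  calc ∫ x, conv (moll n k) p x * w x
      = ∫ x, ∫ t, p t * moll n k (x - t) * w x := by
        refine integral_congr_ae (Eventually.of_forall fun x => ?_)
        simp only [conv_apply, integral_mul_const]
    _ = ∫ t, ∫ x, p t * moll n k (x - t) * w x := integral_integral_swap hi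
    _ = ∫ t, p t * conv (moll n k) w t := by
        refine integral_congr_ae (Eventually.of_forall fun t => ?_)
        simp only [conv_apply, ← integral_const_mul]
        refine integral_congr_ae (Eventually.of_forall fun x => ?_)
        simp only [moll_sub_comm k x t]
        ring

lemma abs_conv_moll_le {w : Euc n → ℝ} {C : ℝ} (hC : ∀ x, |w x| ≤ C) (k : ℕ) (x : Euc n) :
    |conv (moll n k) w x| ≤ C := by
  rw [conv_apply]
  calc |∫ t, w t * moll n k (x - t)| ≤ ∫ t, C * moll n k (x - t) := by
        rw [← Real.norm_eq_abs]
        refine norm_integral_le_of_norm_le (((integrable_moll n k).comp_sub_left x).const_mul C)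
          (Eventually.of_forall fun t => ?_)
        rw [Real.norm_eq_abs, abs_mul, abs_of_nonneg (moll_nonneg k _)]
        exact mul_le_mul_of_nonneg_right (hC t) (moll_nonneg k _)
    _ = C := by rw [integral_const_mul, integral_moll_sub, mul_one]

lemma tendsto_integral_conv_mul {p w : Euc n → ℝ} (hp : LocallyIntegrable p) (hw : Continuous w)
    (hwc : HasCompactSupport w) :
    Tendsto (fun k => ∫ x, conv (moll n k) p x * w x) atTop (𝓝 (∫ x, p x * w x)) := by
  simp_rw [integral_conv_mul hp hw hwc]
  obtain ⟨C, hC⟩ := hwc.exists_bound_of_continuous hw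
  set K : Set (Euc n) := Metric.cthickening 1 (tsupport w)
  have hKc : IsCompact K := hwc.isCompact.cthickening
  have hq : Integrable (K.indicator p) :=
    (hp.integrableOn_isCompact hKc).integrable_indicator hKc.measurableSet
  refine tendsto_integral_of_dominated_convergence (fun x => C * |K.indicator p x|) ?_
    (hq.abs.const_mul C) ?_ ?_
  · intro k
    exact hp.aestronglyMeasurable.mul (contDiff_conv hw.locallyIntegrable (contDiff_moll k)
      (hasCompactSupport_moll k)).continuous.aestronglyMeasurable
  · intro k
    refine Eventually.of_forall fun t => ?_
    by_cases ht : t ∈ K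
    · rw [indicator_of_mem ht, norm_mul, mul_comm]
      exact mul_le_mul_of_nonneg_right (abs_conv_moll_le hC k t) (norm_nonneg _)
    · have : conv (moll n k) w t = 0 := by
        rw [conv_apply, ← integral_zero (Euc n) ℝ]
        refine integral_congr_ae (Eventually.of_forall fun x => ?_)
        simp only
        by_cases hx : x ∈ tsupport w
        · have hd : 1 / ((k : ℝ) + 1) ≤ ‖t - x‖ := by
            by_contra! hlt
            refine ht (Metric.mem_cthickening_of_dist_le t x 1 _ hx ?_)
            rw [dist_eq_norm]
            refine hlt.le.trans ?_
            rw [div_le_one (by positivity)]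
            linarith [(Nat.cast_nonneg k : (0 : ℝ) ≤ k)]
          rw [moll_eq_zero hd, mul_zero]
        · rw [image_eq_zero_of_notMem_tsupport hx, zero_mul]
      simp [this, indicator_of_notMem ht]
  · exact Eventually.of_forall fun t => (tendsto_conv_of_continuous hw t).const_mul _

lemma pd_comp_sub_left {φ : Euc n → ℝ} (hφ : ContDiff ℝ ∞ φ) (i : Fin n) (x t : Euc n) :
    pd i (fun t => φ (x - t)) t = - pd i φ (x - t) := by
  have h : HasFDerivAt (fun t => φ (x - t)) _ t :=
    (differentiable_of_smooth hφ (x - t)).hasFDerivAt.comp t ((hasFDerivAt_id t).const_sub x)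
  unfold pd
  rw [h.fderiv]
  simp

lemma hasCompactSupport_comp_sub_left {φ : Euc n → ℝ} (hφ : HasCompactSupport φ) (x : Euc n) :
    HasCompactSupport (fun t => φ (x - t)) :=
  hφ.comp_homeomorph (Homeomorph.subLeft x)

lemma contDiff_comp_sub_left {φ : Euc n → ℝ} (hφ : ContDiff ℝ ∞ φ) (x : Euc n) :
    ContDiff ℝ ∞ (fun t => φ (x - t)) :=
  hφ.comp (contDiff_const.sub contDiff_id)

lemma fderiv_eq_zero_of_pd {f : Euc n → ℝ} {x : Euc n} (h : ∀ i, pd i f x = 0) :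
    fderiv ℝ f x = 0 := by
  apply ContinuousLinearMap.coe_injective
  refine (EuclideanSpace.basisFun (Fin n) ℝ).toBasis.ext fun i => ?_
  simpa [pd] using h i

/-- A locally integrable function with vanishing weak gradient is constant. -/
lemma ae_const_of_weak_gradient_eq_zero {g : Euc n → ℝ} (hg : LocallyIntegrable g)
    (h : ∀ η : Euc n → ℝ, ContDiff ℝ ∞ η → HasCompactSupport η → ∀ i, ∫ x, g x * pd i η x = 0) :
    ∃ c, ∀ᵐ x, g x = c := by
  have hconst : ∀ k x y, conv (moll n k) g x = conv (moll n k) g y := by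
    intro k
    refine is_const_of_fderiv_eq_zero (𝕜 := ℝ) (differentiable_of_smooth
      (contDiff_conv hg (contDiff_moll k) (hasCompactSupport_moll k))) fun x => ?_
    refine fderiv_eq_zero_of_pd fun i => ?_
    rw [pd_conv hg (contDiff_moll k) (hasCompactSupport_moll k), conv_apply]
    have := h _ (contDiff_comp_sub_left (contDiff_moll k) x)
      (hasCompactSupport_comp_sub_left (hasCompactSupport_moll k) x) i
    simp_rw [pd_comp_sub_left (contDiff_moll k), mul_neg, integral_neg] at this
    linarith
  have hae := ae_tendsto_conv hg
  obtain ⟨x₀, hx₀⟩ := hae.exists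
  refine ⟨g x₀, ?_⟩
  filter_upwards [hae] with x hx
  exact tendsto_nhds_unique hx (hx₀.congr fun k => hconst k x₀ x)

lemma pd_exp {U : Euc n → ℝ} (hU : ContDiff ℝ ∞ U) (i : Fin n) (x : Euc n) :
    pd i (fun x => Real.exp (U x)) x = pd i U x * Real.exp (U x) := by
  unfold pd
  rw [((differentiable_of_smooth hU x).hasFDerivAt.exp).fderiv]
  simp [mul_comm]

lemma exists_cutoff {K : Set (Euc n)} (hK : IsCompact K) {c : ℝ} (hc : 0 < c) :
    ∃ χ : Euc n → ℝ, ContDiff ℝ ∞ χ ∧ HasCompactSupport χ ∧ (∀ x, 0 ≤ χ x ∧ χ x ≤ 1) ∧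
      (∀ x ∈ K, χ x = 1) ∧ ∀ i x, |pd i χ x| ≤ c := by
  let f : ContDiffBump (0 : Euc n) := ⟨1, 2, one_pos, one_lt_two⟩
  have hf : ContDiff ℝ ∞ f := f.contDiff
  obtain ⟨C, hC⟩ := (f.hasCompactSupport.fderiv ℝ).exists_bound_of_continuous
    (hf.continuous_fderiv (by simp))
  obtain ⟨R, hR⟩ := hK.isBounded.exists_norm_le
  set r : ℝ := max (max R 1) (C / c)
  have hr : 0 < r := lt_of_lt_of_le one_pos ((le_max_right _ _).trans (le_max_left _ _))
  refine ⟨fun x => f (r⁻¹ • x), hf.comp (contDiff_const_smul _), ?_,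
    fun x => ⟨f.nonneg, f.le_one⟩, ?_, ?_⟩
  · exact f.hasCompactSupport.comp_homeomorph (Homeomorph.smulOfNeZero r⁻¹ (by positivity))
  · intro x hx
    apply f.one_of_mem_closedBall
    rw [mem_closedBall_zero_iff, norm_smul, norm_inv, Real.norm_of_nonneg hr.le,
      inv_mul_le_iff₀ hr]
    change ‖x‖ ≤ r * 1
    rw [mul_one]
    exact (hR x hx).trans ((le_max_left _ _).trans (le_max_left _ _))
  · intro i x
    have h : HasFDerivAt (fun x => f (r⁻¹ • x)) _ x :=
      (differentiable_of_smooth hf (r⁻¹ • x)).hasFDerivAt.comp x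
        ((hasFDerivAt_id x).const_smul r⁻¹)
    unfold pd
    rw [h.fderiv]
    simp only [ContinuousLinearMap.comp_apply, _root_.smul_apply,
      ContinuousLinearMap.id_apply, map_smul, smul_eq_mul, abs_mul, abs_inv, abs_of_pos hr]
    rw [inv_mul_le_iff₀ hr]
    have h1 : |fderiv ℝ f (r⁻¹ • x) (EuclideanSpace.single i 1)| ≤ C := by
      have := (fderiv ℝ f (r⁻¹ • x)).le_opNorm (EuclideanSpace.single i (1 : ℝ))
      rw [PiLp.norm_single, norm_one, mul_one] at this
      exact this.trans (hC _)
    refine h1.trans ?_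
    rw [← div_le_iff₀ hc]
    exact le_max_right _ _

lemma eventually_abs_sub_lt {f : Euc n → ℝ} (hf : Continuous f) {K : Set (Euc n)}
    (hK : IsCompact K) {η : ℝ} (hη : 0 < η) :
    ∀ᶠ k : ℕ in atTop, ∀ x ∈ K, ∀ t, ‖x - t‖ < 1 / ((k : ℝ) + 1) → |f x - f t| < η := by
  have h := hK.uniformContinuousAt_of_continuousAt f (fun x _ => hf.continuousAt)
    (Metric.dist_mem_uniformity hη)
  obtain ⟨δ, hδ, hδ'⟩ := Metric.mem_uniformity_dist.1 h
  filter_upwards [(tendsto_one_div_add_atTop_nhds_zero_nat (𝕜 := ℝ)).eventually_lt_const hδ]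
    with k hk x hx t ht
  have := hδ' (a := x) (b := t) (by rw [dist_eq_norm]; exact ht.trans hk) hx
  simpa [Real.dist_eq] using this

/-- Caccioppoli-type estimate. -/
lemma energy_estimate {U q χ : Euc n → ℝ} {H : Fin n → Euc n → ℝ} (hU : ContDiff ℝ ∞ U)
    (hq : ContDiff ℝ ∞ q) (hχ : ContDiff ℝ ∞ χ) (hχc : HasCompactSupport χ)
    (hH : ∀ i, ContDiff ℝ ∞ (H i))
    (hdiv : ∀ x, ∑ i, pd i (fun x => pd i q x + H i x) x = 0) :
    ∫ x, ∑ i, χ x ^ 2 * Real.exp (-U x) * pd i (fun x => q x * Real.exp (U x)) x ^ 2 ≤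
      ∫ x, ∑ i, (10 * pd i χ x ^ 2 * q x ^ 2 * Real.exp (U x)
        + 4 * χ x ^ 2 * (pd i U x * q x - H i x) ^ 2 * Real.exp (U x)) := by
  set G : Euc n → ℝ := fun x => q x * Real.exp (U x) with hG
  have hGs : ContDiff ℝ ∞ G := hq.mul hU.exp
  have hψ : ContDiff ℝ ∞ (fun x => χ x * χ x * G x) := (hχ.mul hχ).mul hGs
  have hψc : HasCompactSupport (fun x => χ x * χ x * G x) := hχc.mul_right.mul_right
  have hF : ∀ i, ContDiff ℝ ∞ (fun x => pd i q x + H i x) := fun i => (contDiff_pd hq i).add (hH i)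
  have ii : ∀ i, Integrable (fun x => (pd i q x + H i x) * pd i (fun x => χ x * χ x * G x) x) :=
    fun i => integrable_of_compact ((hF i).continuous.mul (contDiff_pd hψ i).continuous)
      (hasCompactSupport_pd hψc i).mul_left
  have hzero : ∫ x, ∑ i, (pd i q x + H i x) * pd i (fun x => χ x * χ x * G x) x = 0 := by
    rw [integral_finsetSum _ fun i _ => ii i]
    have : ∀ i, ∫ x, (pd i q x + H i x) * pd i (fun x => χ x * χ x * G x) x =
        -∫ x, pd i (fun x => pd i q x + H i x) x * (χ x * χ x * G x) := by
      intro i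
      rw [integral_pd_mul (hF i) hψ hψc, neg_neg]
    simp_rw [this]
    rw [Finset.sum_neg_distrib, ← integral_finsetSum]
    · simp_rw [← Finset.sum_mul, hdiv]
      simp
    · exact fun i _ => integrable_of_compact ((contDiff_pd (hF i) i).continuous.mul
        hψ.continuous) hψc.mul_left
  have hρ := contDiff_density hU
  have i1 : Integrable (fun x => ∑ i, χ x ^ 2 * Real.exp (-U x) * pd i G x ^ 2) := by
    refine integrable_of_compact ?_ (hasCompactSupport_sum _ fun i => ?_)
    · exact (ContDiff.sum fun i _ => ((hχ.pow 2).mul hρ).mul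
        ((contDiff_pd hGs i).pow 2)).continuous
    · simp_rw [pow_two (χ _)]
      exact hχc.mul_right.mul_right.mul_right
  have i2 : Integrable (fun x => ∑ i, (10 * pd i χ x ^ 2 * q x ^ 2 * Real.exp (U x)
        + 4 * χ x ^ 2 * (pd i U x * q x - H i x) ^ 2 * Real.exp (U x))) := by
    refine integrable_of_compact ?_ (hasCompactSupport_sum _ fun i => ?_)
    · exact (ContDiff.sum fun i _ => (((contDiff_const.mul ((contDiff_pd hχ i).pow 2)).mul
        (hq.pow 2)).mul hU.exp).add (((contDiff_const.mul (hχ.pow 2)).mul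
        ((((contDiff_pd hU i).mul hq).sub (hH i)).pow 2)).mul hU.exp)).continuous
    · simp_rw [pow_two (χ _), pow_two (pd i χ _)]
      exact ((hasCompactSupport_pd hχc i).mul_right.mul_left.mul_right.mul_right).add
        hχc.mul_right.mul_left.mul_right.mul_right
  have i3 : Integrable (fun x => ∑ i, (pd i q x + H i x) *
      pd i (fun x => χ x * χ x * G x) x) := integrable_finsetSum _ fun i _ => ii i
  have hpt : ∀ x, ∑ i, χ x ^ 2 * Real.exp (-U x) * pd i G x ^ 2 ≤
      (∑ i, (10 * pd i χ x ^ 2 * q x ^ 2 * Real.exp (U x)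
        + 4 * χ x ^ 2 * (pd i U x * q x - H i x) ^ 2 * Real.exp (U x)))
      + 2 * ∑ i, (pd i q x + H i x) * pd i (fun x => χ x * χ x * G x) x := by
    intro x
    rw [Finset.mul_sum, ← Finset.sum_add_distrib]
    refine Finset.sum_le_sum fun i _ => ?_
    have hEρ : Real.exp (U x) * Real.exp (-U x) = 1 := by rw [← Real.exp_add]; simp
    have hGx : pd i G x = q x * (pd i U x * Real.exp (U x)) + pd i q x * Real.exp (U x) := by
      rw [hG, pd_mul hq hU.exp, pd_exp hU]
    have hψx : pd i (fun x => χ x * χ x * G x) x =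
        χ x * χ x * pd i G x + 2 * χ x * pd i χ x * G x := by
      rw [pd_mul (hχ.mul hχ) hGs, pd_mul hχ hχ]; ring
    have hqx : q x = Real.exp (-U x) * G x := by
      rw [hG]; linear_combination (-q x) * hEρ
    have hqi : pd i q x = Real.exp (-U x) * pd i G x - pd i U x * q x := by
      rw [hGx]; linear_combination (-(q x * pd i U x) - pd i q x) * hEρ
    rw [hψx, hqi]
    set R := pd i U x * q x - H i x with hR
    have hH' : H i x = pd i U x * q x - R := by rw [hR]; ring
    rw [hH']
    have hq2 : q x ^ 2 * Real.exp (U x) = Real.exp (-U x) * G x ^ 2 := by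
      rw [hqx]; linear_combination (Real.exp (-U x) * G x ^ 2) * hEρ
    have e1 : 10 * pd i χ x ^ 2 * q x ^ 2 * Real.exp (U x) =
        10 * pd i χ x ^ 2 * (Real.exp (-U x) * G x ^ 2) := by rw [← hq2]; ring
    rw [e1]
    have p1 := mul_nonneg (Real.exp_pos (-U x)).le
      (sq_nonneg (1 / 2 * χ x * pd i G x + 2 * pd i χ x * G x))
    have p2 := mul_nonneg (Real.exp_pos (U x)).le
      (sq_nonneg (1 / 2 * Real.exp (-U x) * χ x * pd i G x - χ x * R))
    have p3 := mul_nonneg (Real.exp_pos (U x)).le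
      (sq_nonneg (χ x * R - Real.exp (-U x) * pd i χ x * G x))
    have q2 : Real.exp (U x) * (1 / 2 * Real.exp (-U x) * χ x * pd i G x - χ x * R) ^ 2 =
        1 / 4 * Real.exp (-U x) * χ x ^ 2 * pd i G x ^ 2 - χ x ^ 2 * pd i G x * R
          + χ x ^ 2 * R ^ 2 * Real.exp (U x) := by
      linear_combination (1 / 4 * Real.exp (-U x) * χ x ^ 2 * pd i G x ^ 2
        - χ x ^ 2 * pd i G x * R) * hEρ
    have q3 : Real.exp (U x) * (χ x * R - Real.exp (-U x) * pd i χ x * G x) ^ 2 =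
        χ x ^ 2 * R ^ 2 * Real.exp (U x) - 2 * χ x * R * pd i χ x * G x
          + Real.exp (-U x) * pd i χ x ^ 2 * G x ^ 2 := by
      linear_combination (Real.exp (-U x) * pd i χ x ^ 2 * G x ^ 2
        - 2 * χ x * R * pd i χ x * G x) * hEρ
    rw [q2] at p2
    rw [q3] at p3
    nlinarith [p1, p2, p3]
  calc _ ≤ ∫ x, ((∑ i, (10 * pd i χ x ^ 2 * q x ^ 2 * Real.exp (U x)
        + 4 * χ x ^ 2 * (pd i U x * q x - H i x) ^ 2 * Real.exp (U x)))
      + 2 * ∑ i, (pd i q x + H i x) * pd i (fun x => χ x * χ x * G x) x) :=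
        integral_mono i1 (i2.add (i3.const_mul 2)) hpt
    _ = _ := by
        rw [integral_add i2 (i3.const_mul 2), integral_const_mul, hzero]
        ring

lemma locallyIntegrable_of_sq {p : Euc n → ℝ} (hm : AEStronglyMeasurable p)
    (h : LocallyIntegrable fun x => p x ^ 2) : LocallyIntegrable p := by
  refine (h.add (continuous_const (y := (1 : ℝ))).locallyIntegrable).mono hm
    (Eventually.of_forall fun x => ?_)
  simp only [Pi.add_apply, Real.norm_eq_abs]
  rw [abs_of_nonneg (by positivity : 0 ≤ p x ^ 2 + 1)]
  nlinarith [sq_abs (p x), sq_nonneg (|p x| - 1)]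

lemma sq_conv_moll_le {p : Euc n → ℝ} (hp : LocallyIntegrable p)
    (hp2 : LocallyIntegrable fun x => p x ^ 2) (k : ℕ) (x : Euc n) :
    conv (moll n k) p x ^ 2 ≤ conv (moll n k) (fun x => p x ^ 2) x := by
  have i1 := integrable_conv_integrand hp (contDiff_moll k).continuous
    (hasCompactSupport_moll k) x
  have i2 := integrable_conv_integrand hp2 (contDiff_moll k).continuous
    (hasCompactSupport_moll k) x
  have i3 := (integrable_moll n k).comp_sub_left x
  set c := conv (moll n k) p x with hc
  have h0 : 0 ≤ ∫ t, (p t - c) ^ 2 * moll n k (x - t) :=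
    integral_nonneg fun t => mul_nonneg (sq_nonneg _) (moll_nonneg k _)
  have h1 : ∫ t, (p t - c) ^ 2 * moll n k (x - t) =
      ∫ t, (p t ^ 2 * moll n k (x - t) - 2 * c * (p t * moll n k (x - t))
        + c ^ 2 * moll n k (x - t)) := by
    congr 1; ext t; ring
  have i4 : Integrable fun t => p t ^ 2 * moll n k (x - t)
      - 2 * c * (p t * moll n k (x - t)) := i2.sub (i1.const_mul _)
  rw [h1, integral_add i4 (i3.const_mul _),
    integral_sub i2 (i1.const_mul _), integral_const_mul, integral_const_mul,
    integral_moll_sub, ← conv_apply, ← conv_apply, ← hc] at h0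
  nlinarith

lemma conv_mono {p q : Euc n → ℝ} (hp : LocallyIntegrable p) (hq : LocallyIntegrable q) {k : ℕ}
    {x : Euc n} (h : ∀ t, ‖x - t‖ < 1 / ((k : ℝ) + 1) → p t ≤ q t) :
    conv (moll n k) p x ≤ conv (moll n k) q x := by
  refine integral_mono (integrable_conv_integrand hp (contDiff_moll k).continuous
    (hasCompactSupport_moll k) x) (integrable_conv_integrand hq (contDiff_moll k).continuous
    (hasCompactSupport_moll k) x) fun t => ?_
  by_cases ht : ‖x - t‖ < 1 / ((k : ℝ) + 1)
  · exact mul_le_mul_of_nonneg_right (h t ht) (moll_nonneg k _)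
  · simp [moll_eq_zero (not_lt.1 ht)]

lemma conv_const_mul (φ p : Euc n → ℝ) (c : ℝ) (x : Euc n) :
    conv φ (fun x => c * p x) x = c * conv φ p x := by
  simp_rw [conv_apply, mul_assoc, integral_const_mul]

lemma conv_sub {φ p q : Euc n → ℝ} (hp : LocallyIntegrable p) (hq : LocallyIntegrable q)
    (hφ : Continuous φ) (hc : HasCompactSupport φ) (x : Euc n) :
    conv φ (fun x => p x - q x) x = conv φ p x - conv φ q x := by
  simp_rw [conv_apply, sub_mul]
  exact integral_sub (integrable_conv_integrand hp hφ hc x) (integrable_conv_integrand hq hφ hc x)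

lemma abs_conv_moll_le_conv {p q : Euc n → ℝ} (hp : LocallyIntegrable p)
    (hq : LocallyIntegrable q) {k : ℕ} {x : Euc n}
    (h : ∀ t, ‖x - t‖ < 1 / ((k : ℝ) + 1) → |p t| ≤ q t) :
    |conv (moll n k) p x| ≤ conv (moll n k) q x := by
  refine abs_le.2 ⟨?_, conv_mono hp hq fun t ht => (abs_le.1 (h t ht)).2⟩
  have := conv_mono (k := k) (x := x) (p := fun t => -1 * q t) (hq.continuous_mul continuous_const)
    hp fun t ht => by have := (abs_le.1 (h t ht)).1; linarith
  rw [conv_const_mul] at this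
  linarith

section Liouville

variable {U g : Euc n → ℝ}

lemma locallyIntegrable_sq_density (hU : ContDiff ℝ ∞ U)
    (hg : Integrable fun x => g x ^ 2 * Real.exp (-U x)) :
    LocallyIntegrable fun x => (g x * Real.exp (-U x)) ^ 2 := by
  have h := hg.locallyIntegrable.mul_continuous (contDiff_density hU).continuous
  have e : (fun x => (g x * Real.exp (-U x)) ^ 2) =
      fun x => g x ^ 2 * Real.exp (-U x) * Real.exp (-U x) := by
    ext x; ring
  rw [e]; exact h

lemma locallyIntegrable_density (hU : ContDiff ℝ ∞ U) (hm : AEStronglyMeasurable g)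
    (hg : Integrable fun x => g x ^ 2 * Real.exp (-U x)) :
    LocallyIntegrable fun x => g x * Real.exp (-U x) :=
  locallyIntegrable_of_sq (hm.mul (contDiff_density hU).continuous.aestronglyMeasurable)
    (locallyIntegrable_sq_density hU hg)

lemma divergence_conv_eq_zero (hU : ContDiff ℝ ∞ U) (hm : AEStronglyMeasurable g)
    (hg : Integrable fun x => g x ^ 2 * Real.exp (-U x))
    (hL : ∀ u : Euc n → ℝ, ContDiff ℝ ∞ u → HasCompactSupport u →
      ∫ x, g x * gen U u x * Real.exp (-U x) = 0) (k : ℕ) (x : Euc n) :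
    ∑ i, pd i (fun x => pd i (conv (moll n k) fun x => g x * Real.exp (-U x)) x
      + conv (moll n k) (fun x => g x * Real.exp (-U x) * pd i U x) x) x = 0 := by
  set p : Euc n → ℝ := fun x => g x * Real.exp (-U x) with hp
  have hpl : LocallyIntegrable p := locallyIntegrable_density hU hm hg
  have hpU : ∀ i, LocallyIntegrable fun x => p x * pd i U x := fun i =>
    hpl.mul_continuous (contDiff_pd hU i).continuous
  have hφ := contDiff_moll (n := n) k
  have hφc := hasCompactSupport_moll (n := n) k
  have e : ∀ i, pd i (fun x => pd i (conv (moll n k) p) x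
      + conv (moll n k) (fun x => p x * pd i U x) x) x =
      ∫ t, (p t * pd i (pd i (moll n k)) (x - t)
        + p t * pd i U t * pd i (moll n k) (x - t)) := by
    intro i
    have h1 : pd i (conv (moll n k) p) = conv (pd i (moll n k)) p := by
      ext y; exact pd_conv hpl hφ hφc i y
    rw [pd_add (contDiff_pd (contDiff_conv hpl hφ hφc) i) (contDiff_conv (hpU i) hφ hφc), h1,
      pd_conv hpl (contDiff_pd hφ i) (hasCompactSupport_pd hφc i), pd_conv (hpU i) hφ hφc,
      conv_apply, conv_apply]
    exact (integral_add (integrable_conv_integrand hpl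
      (contDiff_pd (contDiff_pd hφ i) i).continuous
      (hasCompactSupport_pd (hasCompactSupport_pd hφc i) i) x) (integrable_conv_integrand (hpU i)
      (contDiff_pd hφ i).continuous (hasCompactSupport_pd hφc i) x)).symm
  rw [Finset.sum_congr rfl fun i _ => e i, ← integral_finsetSum,
    ← hL _ (contDiff_comp_sub_left hφ x) (hasCompactSupport_comp_sub_left hφc x)]
  · refine integral_congr_ae (Eventually.of_forall fun t => ?_)
    simp only [gen]
    rw [Finset.mul_sum, Finset.sum_mul]
    refine Finset.sum_congr rfl fun i _ => ?_
    have h2 : pd i (fun t => moll n k (x - t)) = fun t => -1 * pd i (moll n k) (x - t) := by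
      ext s; rw [pd_comp_sub_left hφ]; ring
    rw [h2, pd_const_mul (contDiff_comp_sub_left (contDiff_pd hφ i) x),
      pd_comp_sub_left (contDiff_pd hφ i)]
    rw [hp]
    ring
  · exact fun i _ => (integrable_conv_integrand hpl
      (contDiff_pd (contDiff_pd hφ i) i).continuous
      (hasCompactSupport_pd (hasCompactSupport_pd hφc i) i) x).add
      (integrable_conv_integrand (hpU i)
      (contDiff_pd hφ i).continuous (hasCompactSupport_pd hφc i) x)

lemma eventually_energy_le (hU : ContDiff ℝ ∞ U) (hm : AEStronglyMeasurable g)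
    (hg : Integrable fun x => g x ^ 2 * Real.exp (-U x))
    (hL : ∀ u : Euc n → ℝ, ContDiff ℝ ∞ u → HasCompactSupport u →
      ∫ x, g x * gen U u x * Real.exp (-U x) = 0) {χ : Euc n → ℝ} (hχ : ContDiff ℝ ∞ χ)
    (hχc : HasCompactSupport χ) (hχ1 : ∀ x, 0 ≤ χ x ∧ χ x ≤ 1) {c : ℝ} (hc : 0 < c)
    (hχ2 : ∀ i x, |pd i χ x| ≤ c) :
    ∀ᶠ k in atTop, ∫ x, ∑ i, χ x ^ 2 * Real.exp (-U x) *
      pd i (fun x => conv (moll n k) (fun x => g x * Real.exp (-U x)) x * Real.exp (U x)) x ^ 2 ≤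
      28 * n * c ^ 2 * ∫ x, g x ^ 2 * Real.exp (-U x) := by
  set p : Euc n → ℝ := fun x => g x * Real.exp (-U x) with hp
  have hpl : LocallyIntegrable p := locallyIntegrable_density hU hm hg
  have hpl2 : LocallyIntegrable fun x => |p x| ^ 2 := by
    simp_rw [sq_abs]; exact locallyIntegrable_sq_density hU hg
  have hpa : LocallyIntegrable fun x => |p x| :=
    locallyIntegrable_of_sq hpl.aestronglyMeasurable.norm hpl2
  have hpU : ∀ i, LocallyIntegrable fun x => p x * pd i U x := fun i =>
    hpl.mul_continuous (contDiff_pd hU i).continuous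
  have hgl := hg.locallyIntegrable
  filter_upwards [eventually_abs_sub_lt hU.continuous hχc.isCompact (Real.log_pos one_lt_two),
    eventually_all.2 fun i => eventually_abs_sub_lt (contDiff_pd hU i).continuous
      hχc.isCompact hc] with k hk1 hk2
  have hφ := contDiff_moll (n := n) k
  have hφc := hasCompactSupport_moll (n := n) k
  refine (energy_estimate hU (contDiff_conv hpl hφ hφc) hχ hχc
    (fun i => contDiff_conv (hpU i) hφ hφc)
    (divergence_conv_eq_zero hU hm hg hL k)).trans ?_
  set N : Euc n → ℝ := conv (moll n k) (fun x => g x ^ 2 * Real.exp (-U x)) with hN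
  have hN0 : ∀ x, 0 ≤ N x := fun x =>
    integral_nonneg fun t => mul_nonneg (by positivity) (moll_nonneg k _)
  have hNi : Integrable N := hg.integrable_convolution _ (integrable_moll n k)
  have hNint : ∫ x, N x = ∫ x, g x ^ 2 * Real.exp (-U x) := by
    rw [hN, conv, integral_convolution _ hg (integrable_moll n k), integral_moll]
    simp
  have key : ∀ x ∈ tsupport χ, ∀ i,
      conv (moll n k) p x ^ 2 * Real.exp (U x) ≤ 2 * N x ∧
      (pd i U x * conv (moll n k) p x - conv (moll n k) (fun x => p x * pd i U x) x) ^ 2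
        * Real.exp (U x) ≤ c ^ 2 * (2 * N x) := by
    intro x hx i
    set P := conv (moll n k) (fun x => |p x|) x with hP
    have hP2 : P ^ 2 * Real.exp (U x) ≤ 2 * N x := by
      refine (mul_le_mul_of_nonneg_right (sq_conv_moll_le hpa hpl2 k x)
        (Real.exp_pos _).le).trans ?_
      rw [mul_comm, ← conv_const_mul, hN, ← conv_const_mul]
      refine conv_mono (hpl2.continuous_mul continuous_const)
        (hgl.continuous_mul continuous_const) fun t ht => ?_
      have h1 : Real.exp (U x) ≤ 2 * Real.exp (U t) := by
        have := (abs_lt.1 (hk1 x hx t ht)).2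
        calc Real.exp (U x) ≤ Real.exp (Real.log 2 + U t) := Real.exp_le_exp.2 (by linarith)
          _ = 2 * Real.exp (U t) := by rw [Real.exp_add, Real.exp_log two_pos]
      have h2 : Real.exp (U t) * Real.exp (-U t) = 1 := by rw [← Real.exp_add]; simp
      calc Real.exp (U x) * |p t| ^ 2 ≤ 2 * Real.exp (U t) * |p t| ^ 2 :=
            mul_le_mul_of_nonneg_right h1 (sq_nonneg _)
        _ = 2 * (g t ^ 2 * Real.exp (-U t)) := by
            rw [sq_abs, hp]
            linear_combination (2 * g t ^ 2 * Real.exp (-U t)) * h2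
    have hq : |conv (moll n k) p x| ≤ P := abs_conv_moll_le_conv hpl hpa fun t _ => le_rfl
    have hR : |pd i U x * conv (moll n k) p x - conv (moll n k) (fun x => p x * pd i U x) x|
        ≤ c * P := by
      rw [← conv_const_mul, ← conv_sub (hpl.continuous_mul continuous_const) (hpU i)
        hφ.continuous hφc, hP, ← conv_const_mul]
      refine abs_conv_moll_le_conv ((hpl.continuous_mul continuous_const).sub (hpU i))
        (hpa.continuous_mul continuous_const) fun t ht => ?_
      have : pd i U x * p t - p t * pd i U t = (pd i U x - pd i U t) * p t := by ring
      change |pd i U x * p t - p t * pd i U t| ≤ _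
      rw [this, abs_mul]
      exact mul_le_mul_of_nonneg_right (hk2 i x hx t ht).le (abs_nonneg _)
    constructor
    · refine (mul_le_mul_of_nonneg_right ?_ (Real.exp_pos _).le).trans hP2
      rw [← sq_abs]
      exact pow_le_pow_left₀ (abs_nonneg _) hq 2
    · calc _ ≤ (c * P) ^ 2 * Real.exp (U x) := by
            refine mul_le_mul_of_nonneg_right ?_ (Real.exp_pos _).le
            rw [← sq_abs]
            exact pow_le_pow_left₀ (abs_nonneg _) hR 2
        _ = c ^ 2 * (P ^ 2 * Real.exp (U x)) := by ring
        _ ≤ _ := mul_le_mul_of_nonneg_left hP2 (sq_nonneg _)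
  rw [← hNint, ← integral_const_mul]
  refine integral_mono_of_nonneg (Eventually.of_forall fun x => ?_) (hNi.const_mul _)
    (Eventually.of_forall fun x => ?_)
  · exact Finset.sum_nonneg fun i _ => by positivity
  · have hb : ∀ i ∈ Finset.univ, 10 * pd i χ x ^ 2 * conv (moll n k) p x ^ 2 * Real.exp (U x)
        + 4 * χ x ^ 2 * (pd i U x * conv (moll n k) p x
          - conv (moll n k) (fun x => p x * pd i U x) x) ^ 2 * Real.exp (U x) ≤
        28 * c ^ 2 * N x := by
      intro i _
      by_cases hx : x ∈ tsupport χ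
      · obtain ⟨k1, k2⟩ := key x hx i
        have h1 : pd i χ x ^ 2 ≤ c ^ 2 := by
          rw [← sq_abs]; exact pow_le_pow_left₀ (abs_nonneg _) (hχ2 i x) 2
        have h2 : χ x ^ 2 ≤ 1 := pow_le_one₀ (hχ1 x).1 (hχ1 x).2
        have b1 : pd i χ x ^ 2 * (conv (moll n k) p x ^ 2 * Real.exp (U x)) ≤
            c ^ 2 * (2 * N x) := mul_le_mul h1 k1 (by positivity) (by positivity)
        have b2 := mul_le_mul h2 k2 (by positivity) (by positivity)
        nlinarith
      · have h1 : χ x = 0 := image_eq_zero_of_notMem_tsupport hx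
        have h2 : pd i χ x = 0 := by
          have : fderiv ℝ χ x = 0 := by
            by_contra hne
            exact hx (support_fderiv_subset ℝ hne)
          simp [pd, this]
        rw [h1, h2]
        have := hN0 x
        simp only [ne_eq, OfNat.ofNat_ne_zero, not_false_eq_true, zero_pow, mul_zero, zero_mul,
          add_zero]
        positivity
    refine (Finset.sum_le_sum hb).trans (le_of_eq ?_)
    simp
    ring

/-- Liouville property: square-integrable functions orthogonal to the range of the generator
are constant. -/
lemma ae_const_of_orthogonal_gen (hU : ContDiff ℝ ∞ U) (hm : AEStronglyMeasurable g)
    (hg : Integrable fun x => g x ^ 2 * Real.exp (-U x))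
    (hL : ∀ u : Euc n → ℝ, ContDiff ℝ ∞ u → HasCompactSupport u →
      ∫ x, g x * gen U u x * Real.exp (-U x) = 0) : ∃ c, ∀ᵐ x, g x = c := by
  have hEρ : ∀ x, Real.exp (-U x) * Real.exp (U x) = 1 := fun x => by rw [← Real.exp_add]; simp
  have hpl := locallyIntegrable_density hU hm hg
  have hgl : LocallyIntegrable g := by
    have := hpl.mul_continuous hU.exp.continuous
    simpa only [mul_assoc, hEρ, mul_one] using this
  refine ae_const_of_weak_gradient_eq_zero hgl fun η hη hηc i => ?_
  have hw : Continuous fun x => Real.exp (U x) * pd i η x :=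
    hU.exp.continuous.mul (contDiff_pd hη i).continuous
  have hwc : HasCompactSupport fun x => Real.exp (U x) * pd i η x :=
    (hasCompactSupport_pd hηc i).mul_left
  have hlim := tendsto_integral_conv_mul hpl hw hwc
  have e0 : ∀ x, g x * Real.exp (-U x) * (Real.exp (U x) * pd i η x) = g x * pd i η x := by
    intro x; linear_combination (g x * pd i η x) * hEρ x
  simp_rw [e0] at hlim
  set N := ∫ x, g x ^ 2 * Real.exp (-U x) with hN
  have hN0 : 0 ≤ N := integral_nonneg fun x => by positivity
  have hηi : Integrable fun x => η x ^ 2 * Real.exp (U x) := by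
    refine integrable_of_compact ((hη.pow 2).mul hU.exp).continuous ?_
    simp_rw [pow_two]
    exact hηc.mul_right.mul_right
  set D := 14 * n * N + 1 / 2 * ∫ x, η x ^ 2 * Real.exp (U x) with hD
  have hbound : ∀ c : ℝ, 0 < c → |∫ x, g x * pd i η x| ≤ c * D := by
    intro c hc
    obtain ⟨χ, hχ, hχc, hχ1, hχK, hχ2⟩ := exists_cutoff hηc.isCompact hc
    refine le_of_tendsto hlim.abs ?_
    filter_upwards [eventually_energy_le hU hm hg hL hχ hχc hχ1 hc hχ2] with k hk
    set q := conv (moll n k) fun x => g x * Real.exp (-U x) with hq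
    have hqs : ContDiff ℝ ∞ q := contDiff_conv hpl (contDiff_moll k) (hasCompactSupport_moll k)
    set G : Euc n → ℝ := fun x => q x * Real.exp (U x) with hG
    have hGs : ContDiff ℝ ∞ G := hqs.mul hU.exp
    have e1 : ∫ x, q x * (Real.exp (U x) * pd i η x) = -∫ x, pd i G x * η x := by
      rw [integral_pd_mul hGs hη hηc, neg_neg]
      congr 1; ext x; rw [hG]; ring
    have hsum : Integrable fun x => ∑ i, χ x ^ 2 * Real.exp (-U x) * pd i G x ^ 2 := by
      refine integrable_of_compact ?_ (hasCompactSupport_sum _ fun i => ?_)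
      · exact (ContDiff.sum fun i _ => ((hχ.pow 2).mul (contDiff_density hU)).mul
          ((contDiff_pd hGs i).pow 2)).continuous
      · simp_rw [pow_two (χ _)]
        exact hχc.mul_right.mul_right.mul_right
    rw [e1, abs_neg, ← Real.norm_eq_abs]
    calc ‖∫ x, pd i G x * η x‖ ≤ ∫ x, (1 / (2 * c) * (∑ i, χ x ^ 2 * Real.exp (-U x) *
            pd i G x ^ 2) + c / 2 * (η x ^ 2 * Real.exp (U x))) := by
          refine norm_integral_le_of_norm_le ((hsum.const_mul _).add (hηi.const_mul _))
            (Eventually.of_forall fun x => ?_)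
          have h1 : χ x ^ 2 * Real.exp (-U x) * pd i G x ^ 2 ≤
              ∑ i, χ x ^ 2 * Real.exp (-U x) * pd i G x ^ 2 :=
            Finset.single_le_sum (f := fun i => χ x ^ 2 * Real.exp (-U x) * pd i G x ^ 2)
              (fun i _ => by positivity) (Finset.mem_univ i)
          refine le_trans ?_ (add_le_add_left (mul_le_mul_of_nonneg_left h1
            (by positivity : 0 ≤ 1 / (2 * c))) _)
          by_cases hx : x ∈ tsupport η
          · rw [hχK x hx, Real.norm_eq_abs]
            have hs := hEρ x
            have hE := Real.exp_pos (U x)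
            have hρ := Real.exp_pos (-U x)
            have a1 : 0 ≤ Real.exp (U x) / (2 * c) *
                (Real.exp (-U x) * pd i G x - c * η x) ^ 2 := by positivity
            have a2 : 0 ≤ Real.exp (U x) / (2 * c) *
                (Real.exp (-U x) * pd i G x + c * η x) ^ 2 := by positivity
            have f1 : Real.exp (U x) / (2 * c) *
                (Real.exp (-U x) * pd i G x - c * η x) ^ 2 =
                1 / (2 * c) * (1 ^ 2 * Real.exp (-U x) * pd i G x ^ 2)
                + c / 2 * (η x ^ 2 * Real.exp (U x)) - pd i G x * η x := by
              field_simp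
              linear_combination (Real.exp (-U x) * pd i G x ^ 2 - 2 * c * pd i G x * η x) * hs
            have f2 : Real.exp (U x) / (2 * c) *
                (Real.exp (-U x) * pd i G x + c * η x) ^ 2 =
                1 / (2 * c) * (1 ^ 2 * Real.exp (-U x) * pd i G x ^ 2)
                + c / 2 * (η x ^ 2 * Real.exp (U x)) + pd i G x * η x := by
              field_simp
              linear_combination (Real.exp (-U x) * pd i G x ^ 2 + 2 * c * pd i G x * η x) * hs
            rw [f1] at a1
            rw [f2] at a2
            exact abs_le.2 ⟨by linarith, by linarith⟩
          · rw [image_eq_zero_of_notMem_tsupport hx]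
            simp only [mul_zero, norm_zero]
            positivity
      _ = 1 / (2 * c) * (∫ x, ∑ i, χ x ^ 2 * Real.exp (-U x) * pd i G x ^ 2)
            + c / 2 * ∫ x, η x ^ 2 * Real.exp (U x) := by
          rw [integral_add (hsum.const_mul _) (hηi.const_mul _), integral_const_mul,
            integral_const_mul]
      _ ≤ 1 / (2 * c) * (28 * n * c ^ 2 * N) + c / 2 * ∫ x, η x ^ 2 * Real.exp (U x) := by
          gcongr
      _ = c * D := by rw [hD]; field_simp; ring
  have : |∫ x, g x * pd i η x| ≤ 0 := by
    have hlim0 : Tendsto (fun c : ℝ => c * D) (𝓝[>] 0) (𝓝 0) := by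
      have : Tendsto (fun c : ℝ => c * D) (𝓝 0) (𝓝 (0 * D)) := tendsto_id.mul_const D
      rw [zero_mul] at this
      exact this.mono_left nhdsWithin_le_nhds
    exact ge_of_tendsto hlim0 (eventually_nhdsWithin_of_forall fun c hc => hbound c hc)
  exact abs_nonpos_iff.1 this

end Liouville

lemma gen_add (U : Euc n → ℝ) {u v : Euc n → ℝ} (hu : ContDiff ℝ ∞ u) (hv : ContDiff ℝ ∞ v)
    (x : Euc n) : gen U (fun x => u x + v x) x = gen U u x + gen U v x := by
  unfold gen
  rw [← Finset.sum_add_distrib]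
  refine Finset.sum_congr rfl fun i _ => ?_
  have h : pd i (fun x => u x + v x) = fun x => pd i u x + pd i v x := by
    ext y; exact pd_add hu hv i y
  rw [h, pd_add (contDiff_pd hu i) (contDiff_pd hv i)]
  ring

lemma gen_const_mul (U : Euc n → ℝ) {u : Euc n → ℝ} (hu : ContDiff ℝ ∞ u) (c : ℝ)
    (x : Euc n) : gen U (fun x => c * u x) x = c * gen U u x := by
  unfold gen
  rw [Finset.mul_sum]
  refine Finset.sum_congr rfl fun i _ => ?_
  have h : pd i (fun x => c * u x) = fun x => c * pd i u x := by
    ext y; exact pd_const_mul hu c i y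
  rw [h, pd_const_mul (contDiff_pd hu i)]
  ring

lemma gen_zero (U : Euc n → ℝ) (x : Euc n) : gen U (fun _ => (0 : ℝ)) x = 0 := by
  have := gen_const_mul U (contDiff_const (c := (0 : ℝ))) 0 x
  simpa using this

/-- The classes in `L²` of the functions `s * gen U u`, for test functions `u`. -/
def genRange (U s : Euc n → ℝ) : Submodule ℝ (Lp ℝ 2 (volume : Measure (Euc n))) where
  carrier := {f | ∃ u : Euc n → ℝ, ContDiff ℝ ∞ u ∧ HasCompactSupport u ∧
    f =ᵐ[volume] fun x => gen U u x * s x}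
  zero_mem' := ⟨fun _ => 0, contDiff_const, HasCompactSupport.zero, by
    filter_upwards [Lp.coeFn_zero ℝ 2 (volume : Measure (Euc n))] with x hx
    rw [hx, gen_zero]; simp⟩
  add_mem' := by
    rintro f g ⟨u, hu, huc, hf⟩ ⟨v, hv, hvc, hg⟩
    refine ⟨fun x => u x + v x, hu.add hv, huc.add hvc, ?_⟩
    filter_upwards [Lp.coeFn_add f g, hf, hg] with x h1 h2 h3
    rw [h1, Pi.add_apply, h2, h3, gen_add U hu hv]
    ring
  smul_mem' := by
    rintro c f ⟨u, hu, huc, hf⟩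
    refine ⟨fun x => c * u x, contDiff_const.mul hu, huc.mul_left, ?_⟩
    filter_upwards [Lp.coeFn_smul c f, hf] with x h1 h2
    rw [h1, Pi.smul_apply, h2, gen_const_mul U hu, smul_eq_mul]
    ring

/-- Mean-zero functions are approximated by the range of the generator on test functions. -/
lemma exists_gen_approx {U w k : Euc n → ℝ} {δ : ℝ} (hU : ContDiff ℝ ∞ U) (hw : Continuous w)
    (hδ : 0 < δ) (hwδ : ∀ x, δ ≤ w x) (hk : Continuous k)
    (hk2 : Integrable fun x => k x ^ 2 / w x * Real.exp (-U x))
    (hk0 : ∫ x, k x * Real.exp (-U x) = 0) {ε : ℝ} (hε : 0 < ε) :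
    ∃ u : Euc n → ℝ, ContDiff ℝ ∞ u ∧ HasCompactSupport u ∧
      ∫ x, (gen U u x - k x) ^ 2 / w x * Real.exp (-U x) < ε := by
  have hw0 : ∀ x, 0 < w x := fun x => hδ.trans_le (hwδ x)
  set s : Euc n → ℝ := fun x => Real.sqrt (Real.exp (-U x) / w x) with hs
  have hρ := (contDiff_density hU).continuous
  have hscont : Continuous s := (hρ.div hw fun x => (hw0 x).ne').sqrt
  have hs2 : ∀ x, s x ^ 2 = Real.exp (-U x) / w x := fun x =>
    Real.sq_sqrt (div_pos (Real.exp_pos _) (hw0 x)).le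
  have hkm : MemLp (fun x => k x * s x) 2 (volume : Measure (Euc n)) := by
    refine (memLp_two_iff_integrable_sq (hk.mul hscont).aestronglyMeasurable).2 ?_
    refine hk2.congr (Eventually.of_forall fun x => ?_)
    simp only [Pi.mul_apply, mul_pow, hs2]
    ring
  have hgm : ∀ u : Euc n → ℝ, ContDiff ℝ ∞ u → HasCompactSupport u →
      MemLp (fun x => gen U u x * s x) 2 (volume : Measure (Euc n)) := fun u hu huc =>
    ((contDiff_gen hU hu).continuous.mul hscont).memLp_of_hasCompactSupport
      (hasCompactSupport_gen U huc).mul_right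
  have hmem : hkm.toLp ∈ (genRange U s)ᗮᗮ := by
    rw [Submodule.mem_orthogonal]
    intro g hg
    rw [Submodule.mem_orthogonal] at hg
    have hgL : ∀ u : Euc n → ℝ, ContDiff ℝ ∞ u → HasCompactSupport u →
        ∫ x, g x * (gen U u x * s x) = 0 := by
      intro u hu huc
      have h := hg (hgm u hu huc).toLp ⟨u, hu, huc, (hgm u hu huc).coeFn_toLp⟩
      rw [L2.inner_def] at h
      rw [← h]
      refine integral_congr_ae ?_
      filter_upwards [(hgm u hu huc).coeFn_toLp] with x hx
      rw [hx]; simp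
    have hgi : Integrable fun x => g x ^ 2 := (Lp.memLp g).integrable_sq
    obtain ⟨c, hc⟩ := ae_const_of_orthogonal_gen (U := U)
      (g := fun x => g x * s x * Real.exp (U x)) hU
      (((Lp.aestronglyMeasurable g).mul hscont.aestronglyMeasurable).mul
        hU.exp.continuous.aestronglyMeasurable)
      (by
        have : Integrable fun x => (w x)⁻¹ * g x ^ 2 := by
          refine hgi.bdd_mul (c := δ⁻¹) (hw.inv₀ fun x => (hw0 x).ne').aestronglyMeasurable
            (Eventually.of_forall fun x => ?_)
          rw [Real.norm_of_nonneg (inv_nonneg.2 (hw0 x).le)]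
          exact inv_anti₀ hδ (hwδ x)
        refine this.congr (Eventually.of_forall fun x => ?_)
        have hE : Real.exp (-U x) * Real.exp (U x) = 1 := by rw [← Real.exp_add]; simp
        simp only [mul_pow, hs2]
        have := (hw0 x).ne'
        field_simp
        linear_combination (-(g x ^ 2) * (Real.exp (U x) * Real.exp (-U x) + 1)) * hE)
      (by
        intro u hu huc
        rw [← hgL u hu huc]
        congr 1; ext x
        have hE : Real.exp (-U x) * Real.exp (U x) = 1 := by rw [← Real.exp_add]; simp
        linear_combination (g x * s x * gen U u x) * hE)
    rw [L2.inner_def]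
    calc ∫ x, inner ℝ (g x) ((hkm.toLp : Lp ℝ 2 (volume : Measure (Euc n))) x)
        = ∫ x, c * (k x * Real.exp (-U x)) := by
          refine integral_congr_ae ?_
          filter_upwards [hkm.coeFn_toLp, hc] with x h1 h2
          rw [h1, ← h2]
          have hE : Real.exp (-U x) * Real.exp (U x) = 1 := by rw [← Real.exp_add]; simp
          simp only [RCLike.inner_apply, conj_trivial]
          linear_combination (-(k x * s x * g x)) * hE
      _ = 0 := by rw [integral_const_mul, hk0, mul_zero]
  rw [Submodule.orthogonal_orthogonal_eq_closure] at hmem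
  have hcl : hkm.toLp ∈ closure (genRange U s : Set (Lp ℝ 2 (volume : Measure (Euc n)))) := by
    exact hmem
  obtain ⟨v, ⟨u, hu, huc, hv⟩, hd⟩ := Metric.mem_closure_iff.1 hcl (Real.sqrt ε)
    (Real.sqrt_pos.2 hε)
  refine ⟨u, hu, huc, ?_⟩
  rw [dist_comm, dist_eq_norm] at hd
  have hd2 : ‖v - hkm.toLp‖ ^ 2 < ε := by
    calc _ < Real.sqrt ε ^ 2 := pow_lt_pow_left₀ hd (norm_nonneg _) two_ne_zero
      _ = ε := Real.sq_sqrt hε.le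
  rw [← real_inner_self_eq_norm_sq, L2.inner_def] at hd2
  refine lt_of_le_of_lt (le_of_eq ?_) hd2
  refine integral_congr_ae ?_
  filter_upwards [Lp.coeFn_sub v hkm.toLp, hv, hkm.coeFn_toLp] with x h1 h2 h3
  rw [h1, Pi.sub_apply, h2, h3, real_inner_self_eq_norm_sq, Real.norm_eq_abs, sq_abs, ← sub_mul,
    mul_pow, hs2]
  ring

section Radial

lemma contDiff_radial {F : ℝ → ℝ} (hF : ContDiff ℝ ∞ F) :
    ContDiff ℝ ∞ fun x : Euc n => F (‖x‖ ^ 2) :=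
  hF.comp (contDiff_norm_sq ℝ)

lemma pd_radial {F : ℝ → ℝ} {F' : ℝ} {x : Euc n} (hF : HasDerivAt F F' (‖x‖ ^ 2)) (i : Fin n) :
    pd i (fun x : Euc n => F (‖x‖ ^ 2)) x = 2 * F' * x i := by
  have h := hF.comp_hasFDerivAt x (hasStrictFDerivAt_norm_sq x).hasFDerivAt
  unfold pd
  have h' : HasFDerivAt (fun x : Euc n => F (‖x‖ ^ 2)) _ x := h
  rw [h'.fderiv]
  simp [EuclideanSpace.inner_single_right]
  ring

lemma pd_coord (i j : Fin n) (x : Euc n) :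
    pd i (fun x : Euc n => x j) x = if i = j then 1 else 0 := by
  have h : HasFDerivAt (fun x : Euc n => x j) (EuclideanSpace.proj (𝕜 := ℝ) j) x :=
    (EuclideanSpace.proj (𝕜 := ℝ) j : Euc n →L[ℝ] ℝ).hasFDerivAt
  unfold pd
  rw [h.fderiv]
  simp [eq_comm]

lemma contDiff_coord (j : Fin n) : ContDiff ℝ ∞ fun x : Euc n => x j :=
  (EuclideanSpace.proj (𝕜 := ℝ) j : Euc n →L[ℝ] ℝ).contDiff

lemma sum_pd_radial {F : ℝ → ℝ} {F' : ℝ} {x : Euc n} (hF : HasDerivAt F F' (‖x‖ ^ 2))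
    (v : Fin n → ℝ) :
    ∑ i, pd i (fun x : Euc n => F (‖x‖ ^ 2)) x * v i = 2 * F' * ∑ i, x i * v i := by
  simp_rw [pd_radial hF, Finset.mul_sum, mul_assoc]

lemma sum_pd_pd_radial {F F₁ : ℝ → ℝ} {F₂ : ℝ} {x : Euc n} (hF : ∀ s, HasDerivAt F (F₁ s) s)
    (hF₁ : ContDiff ℝ ∞ F₁) (hF₂ : HasDerivAt F₁ F₂ (‖x‖ ^ 2)) (v : Fin n → ℝ) :
    ∑ i, ∑ j, pd i (pd j fun x : Euc n => F (‖x‖ ^ 2)) x * v i * v j =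
      2 * F₁ (‖x‖ ^ 2) * (∑ i, v i ^ 2) + 4 * F₂ * (∑ i, x i * v i) ^ 2 := by
  have h1 : ∀ j : Fin n, pd j (fun x : Euc n => F (‖x‖ ^ 2)) =
      fun x => 2 * (F₁ (‖x‖ ^ 2) * x j) := by
    intro j; ext y; rw [pd_radial (hF _)]; ring
  have h2 : ∀ i j : Fin n, pd i (pd j fun x : Euc n => F (‖x‖ ^ 2)) x =
      (if i = j then 2 * F₁ (‖x‖ ^ 2) else 0) + 4 * F₂ * (x i * x j) := by
    intro i j
    rw [h1, pd_const_mul ((contDiff_radial hF₁).mul (contDiff_coord j)),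
      pd_mul (contDiff_radial hF₁) (contDiff_coord j), pd_coord, pd_radial hF₂]
    split_ifs <;> ring
  simp_rw [h2, add_mul, Finset.sum_add_distrib]
  congr 1
  · simp only [ite_mul, zero_mul, Finset.sum_ite_eq, Finset.mem_univ, if_true, Finset.mul_sum]
    exact Finset.sum_congr rfl fun i _ => by ring
  · rw [pow_two, Finset.sum_mul_sum, Finset.mul_sum]
    refine Finset.sum_congr rfl fun i _ => ?_
    rw [Finset.mul_sum]
    exact Finset.sum_congr rfl fun j _ => by ring

lemma sum_sq_coord (x : Euc n) : ∑ i, x i ^ 2 = ‖x‖ ^ 2 := (EuclideanSpace.real_norm_sq_eq x).symm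

end Radial

section Fermi

variable (a b : ℝ)

/-- The Fermi function. -/
noncomputable def fsig (s : ℝ) : ℝ := Real.exp (a * s + b) / (1 + Real.exp (a * s + b))

/-- The radial profile of the smoothed indicator potential. -/
noncomputable def fW (s : ℝ) : ℝ := Real.log (1 + Real.exp (a * s + b))

/-- The radial profile of the weight in the auxiliary Bochner identity. -/
noncomputable def fzeta (s : ℝ) : ℝ :=
  1 / (2 * a) * ((1 + Real.exp (a * s + b)) * (fW a b s - (a * s + b)))

variable {a b}

lemma one_add_exp_pos (t : ℝ) : 0 < 1 + Real.exp t := by positivity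

lemma fsig_pos (s : ℝ) : 0 < fsig a b s := by unfold fsig; positivity

lemma fsig_lt_one (s : ℝ) : fsig a b s < 1 := by
  unfold fsig; rw [div_lt_one (one_add_exp_pos _)]; linarith

lemma one_sub_fsig (s : ℝ) : 1 - fsig a b s = 1 / (1 + Real.exp (a * s + b)) := by
  have := (one_add_exp_pos (a * s + b)).ne'
  unfold fsig; field_simp; ring

lemma hasDerivAt_affine (s : ℝ) : HasDerivAt (fun s => a * s + b) a s := by
  simpa using ((hasDerivAt_id s).const_mul a).add_const b

lemma hasDerivAt_fW (s : ℝ) : HasDerivAt (fW a b) (a * fsig a b s) s := by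
  have h := (((hasDerivAt_affine (a := a) (b := b) s).exp).const_add 1).log
    (one_add_exp_pos _).ne'
  refine (show HasDerivAt (fW a b) _ s from h).congr_deriv ?_
  unfold fsig; ring

lemma hasDerivAt_fsig (s : ℝ) :
    HasDerivAt (fsig a b) (a * fsig a b s * (1 - fsig a b s)) s := by
  have h1 := (hasDerivAt_affine (a := a) (b := b) s).exp
  have h := h1.div (h1.const_add 1) (one_add_exp_pos _).ne'
  refine (show HasDerivAt (fsig a b) _ s from h).congr_deriv ?_
  have := (one_add_exp_pos (a * s + b)).ne'
  rw [one_sub_fsig]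
  unfold fsig; field_simp; ring

lemma fsig_mul_fzeta (ha : 0 < a) (s : ℝ) :
    2 * a * fsig a b s * fzeta a b s = Real.exp (a * s + b) * (fW a b s - (a * s + b)) := by
  have := (one_add_exp_pos (a * s + b)).ne'
  unfold fsig fzeta; field_simp

lemma hasDerivAt_fzeta (ha : 0 < a) (s : ℝ) :
    HasDerivAt (fzeta a b) (1 / 2 * (2 * a * fsig a b s * fzeta a b s - 1)) s := by
  have h1 := (hasDerivAt_affine (a := a) (b := b) s).exp
  have h := ((h1.const_add 1).mul ((hasDerivAt_fW (a := a) (b := b) s).sub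
    (hasDerivAt_affine (a := a) (b := b) s))).const_mul (1 / (2 * a))
  refine (show HasDerivAt (fzeta a b) _ s from h).congr_deriv ?_
  rw [fsig_mul_fzeta ha]
  have e : a * fsig a b s - a = -a * (1 - fsig a b s) := by ring
  have := (one_add_exp_pos (a * s + b)).ne'
  simp only [Pi.sub_apply]
  rw [e, one_sub_fsig]
  field_simp
  ring

lemma fW_sub_nonneg (s : ℝ) : 0 ≤ fW a b s - (a * s + b) := by
  unfold fW
  rw [sub_nonneg, Real.le_log_iff_exp_le (one_add_exp_pos _)]
  linarith

lemma fzeta_nonneg (ha : 0 < a) (s : ℝ) : 0 ≤ fzeta a b s := by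
  have := fW_sub_nonneg (a := a) (b := b) s
  unfold fzeta; positivity

lemma fsig_mul_fzeta_le (ha : 0 < a) (s : ℝ) : 2 * a * fsig a b s * fzeta a b s ≤ 1 := by
  rw [fsig_mul_fzeta ha]
  have hy := Real.exp_pos (a * s + b)
  have h : fW a b s - (a * s + b) ≤ 1 / Real.exp (a * s + b) := by
    have h1 : fW a b s - (a * s + b) =
        Real.log ((1 + Real.exp (a * s + b)) / Real.exp (a * s + b)) := by
      rw [Real.log_div (one_add_exp_pos _).ne' hy.ne', Real.log_exp, fW]
    rw [h1]
    refine (Real.log_le_sub_one_of_pos (by positivity)).trans (le_of_eq ?_)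
    field_simp; ring
  calc _ ≤ Real.exp (a * s + b) * (1 / Real.exp (a * s + b)) :=
        mul_le_mul_of_nonneg_left h hy.le
    _ = 1 := by field_simp

lemma contDiff_affine : ContDiff ℝ ∞ fun s : ℝ => a * s + b :=
  (contDiff_const.mul contDiff_id).add contDiff_const

lemma contDiff_fsig : ContDiff ℝ ∞ (fsig a b) :=
  contDiff_affine.exp.div (contDiff_const.add contDiff_affine.exp) fun _ =>
    (one_add_exp_pos _).ne'

lemma contDiff_fW : ContDiff ℝ ∞ (fW a b) :=
  (contDiff_const.add contDiff_affine.exp).log fun _ => (one_add_exp_pos _).ne'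

lemma contDiff_fzeta : ContDiff ℝ ∞ (fzeta a b) :=
  contDiff_const.mul ((contDiff_const.add contDiff_affine.exp).mul
    (contDiff_fW.sub contDiff_affine))

lemma exp_neg_fW (s : ℝ) : Real.exp (-fW a b s) = 1 / (1 + Real.exp (a * s + b)) := by
  rw [Real.exp_neg, fW, Real.exp_log (one_add_exp_pos _), one_div]

lemma exp_neg_fW_le (s : ℝ) : Real.exp (-fW a b s) ≤ Real.exp (-b) * Real.exp (-a * s) := by
  rw [← Real.exp_add]
  apply Real.exp_le_exp.2
  have := fW_sub_nonneg (a := a) (b := b) s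
  linarith

lemma fsig_ge (ha : 0 < a) {s : ℝ} (hs : 0 ≤ s) : fsig a b 0 ≤ fsig a b s := by
  unfold fsig
  rw [div_le_div_iff₀ (one_add_exp_pos _) (one_add_exp_pos _)]
  have : Real.exp (a * 0 + b) ≤ Real.exp (a * s + b) := Real.exp_le_exp.2 (by nlinarith)
  nlinarith

end Fermi

section Potential

section Support

lemma pd_eq_zero {u : Euc n → ℝ} {x : Euc n} (hx : x ∉ tsupport u) (i : Fin n) : pd i u x = 0 :=
  image_eq_zero_of_notMem_tsupport fun h => hx (tsupport_fderiv_apply_subset ℝ _ h)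

lemma pd_pd_eq_zero {u : Euc n → ℝ} {x : Euc n} (hx : x ∉ tsupport u) (i j : Fin n) :
    pd i (pd j u) x = 0 :=
  pd_eq_zero (fun h => hx (tsupport_fderiv_apply_subset ℝ _ h)) i

lemma gen_eq_zero (U : Euc n → ℝ) {u : Euc n → ℝ} {x : Euc n} (hx : x ∉ tsupport u) :
    gen U u x = 0 := by
  simp [gen, pd_eq_zero hx, pd_pd_eq_zero hx]

lemma integrable_of_vanish {f u : Euc n → ℝ} (hf : Continuous f) (hc : HasCompactSupport u)
    (h : ∀ x, x ∉ tsupport u → f x = 0) : Integrable f :=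
  integrable_of_compact hf (HasCompactSupport.intro hc h)

lemma integral_comb {f g h k : Euc n → ℝ} (hf : Integrable f) (hg : Integrable g)
    (hh : Integrable h) (hk : Integrable k) :
    ∫ x, (f x + g x + 2 * h x - k x) =
      (∫ x, f x) + (∫ x, g x) + 2 * (∫ x, h x) - ∫ x, k x := by
  have h1 := integral_sub ((hf.add hg).add (hh.const_mul 2)) hk
  have h2 := integral_add (hf.add hg) (hh.const_mul 2)
  have h3 := integral_add hf hg
  rw [integral_const_mul] at h2
  simp only [Pi.add_apply] at h1 h2
  rw [h1, h2, h3]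

end Support

/-- The potential: smoothed ball indicator plus `V`. -/
noncomputable def pot (a b : ℝ) (V : Euc n → ℝ) (x : Euc n) : ℝ := fW a b (‖x‖ ^ 2) + V x

/-- The tangential Hessian eigenvalue of the radial part of `pot`. -/
noncomputable def wt (a b : ℝ) (x : Euc n) : ℝ := 2 * a * fsig a b (‖x‖ ^ 2)

/-- The radial Hessian excess of the radial part of `pot`. -/
noncomputable def bt (a b : ℝ) (x : Euc n) : ℝ :=
  4 * a ^ 2 * (fsig a b (‖x‖ ^ 2) * (1 - fsig a b (‖x‖ ^ 2)))

variable {a b : ℝ} {V : Euc n → ℝ}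

lemma contDiff_pot (hV : ContDiff ℝ ∞ V) : ContDiff ℝ ∞ (pot a b V) :=
  (contDiff_radial contDiff_fW).add hV

lemma contDiff_wt : ContDiff ℝ ∞ (wt a b : Euc n → ℝ) :=
  contDiff_const.mul (contDiff_radial contDiff_fsig)

lemma contDiff_bt : ContDiff ℝ ∞ (bt a b : Euc n → ℝ) :=
  contDiff_const.mul ((contDiff_radial contDiff_fsig).mul
    (contDiff_const.sub (contDiff_radial contDiff_fsig)))

lemma wt_pos (ha : 0 < a) (x : Euc n) : 0 < wt a b x :=
  mul_pos (by positivity) (fsig_pos _)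

lemma wt_ge (ha : 0 < a) (x : Euc n) : 2 * a * fsig a b 0 ≤ wt a b x :=
  mul_le_mul_of_nonneg_left (fsig_ge ha (by positivity)) (by positivity)

lemma wt_le (ha : 0 < a) (x : Euc n) : wt a b x ≤ 2 * a := by
  have := (fsig_lt_one (a := a) (b := b) (‖x‖ ^ 2)).le
  unfold wt; nlinarith

lemma bt_nonneg (x : Euc n) : 0 ≤ bt a b x := by
  have h1 := (fsig_pos (a := a) (b := b) (‖x‖ ^ 2)).le
  have h2 := sub_nonneg.2 (fsig_lt_one (a := a) (b := b) (‖x‖ ^ 2)).le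
  unfold bt; positivity

lemma bt_le (x : Euc n) : bt a b x ≤ 4 * a ^ 2 := by
  have h1 := (fsig_pos (a := a) (b := b) (‖x‖ ^ 2)).le
  have h2 := (fsig_lt_one (a := a) (b := b) (‖x‖ ^ 2)).le
  unfold bt
  refine mul_le_of_le_one_right (by positivity) ?_
  nlinarith

lemma wt_neg (x : Euc n) : wt a b (-x) = wt a b x := by simp [wt]

lemma hasDerivAt_mul_fsig (s : ℝ) :
    HasDerivAt (fun s => a * fsig a b s) (a ^ 2 * (fsig a b s * (1 - fsig a b s))) s :=
  ((hasDerivAt_fsig s).const_mul a).congr_deriv (by ring)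

lemma hessian_pot (hV : ContDiff ℝ ∞ V) (x : Euc n) (v : Fin n → ℝ) :
    ∑ i, ∑ j, pd i (pd j (pot a b V)) x * v i * v j =
      wt a b x * (∑ i, v i ^ 2) + bt a b x * (∑ i, x i * v i) ^ 2
        + ∑ i, ∑ j, pd i (pd j V) x * v i * v j := by
  have hW : ContDiff ℝ ∞ fun x : Euc n => fW a b (‖x‖ ^ 2) := contDiff_radial contDiff_fW
  have e : ∀ i j : Fin n, pd i (pd j (pot a b V)) x =
      pd i (pd j fun x : Euc n => fW a b (‖x‖ ^ 2)) x + pd i (pd j V) x := by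
    intro i j
    have : pd j (pot a b V) = fun x => pd j (fun x : Euc n => fW a b (‖x‖ ^ 2)) x + pd j V x := by
      ext y; exact pd_add hW hV j y
    rw [this, pd_add (contDiff_pd hW j) (contDiff_pd hV j)]
  simp_rw [e, add_mul, Finset.sum_add_distrib]
  rw [sum_pd_pd_radial (fun s => hasDerivAt_fW s) (contDiff_const.mul contDiff_fsig)
    (hasDerivAt_mul_fsig _)]
  simp only [wt, bt]
  ring

lemma hasDerivAt_fzeta_deriv (ha : 0 < a) (s : ℝ) :
    HasDerivAt (fun s => 1 / 2 * (2 * a * fsig a b s * fzeta a b s - 1))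
      (1 / 4 * (4 * a ^ 2 * (fsig a b s * (1 - fsig a b s)) * fzeta a b s
        - 2 * a * fsig a b s * (1 - 2 * a * fsig a b s * fzeta a b s))) s := by
  have h := (((((hasDerivAt_fsig (a := a) (b := b) s).const_mul (2 * a)).mul
    (hasDerivAt_fzeta (b := b) ha s)).sub_const 1).const_mul (1 / 2))
  exact h.congr_deriv (by ring)

lemma continuous_density (hV : ContDiff ℝ ∞ V) :
    Continuous fun x => Real.exp (-pot a b V x) :=
  (contDiff_density (contDiff_pot hV)).continuous

/-- The dual (`H⁻¹`-type) estimate: the energy is controlled by the weighted norm of the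
generator. -/
lemma energy_le_gen (ha : 0 < a) (hV : ContDiff ℝ ∞ V)
    (hconv : ∀ x (v : Fin n → ℝ), 0 ≤ ∑ i, ∑ j, pd i (pd j V) x * v i * v j)
    {ψ : Euc n → ℝ} (hψ : ContDiff ℝ ∞ ψ) (hc : HasCompactSupport ψ) :
    0 ≤ ∫ x, (gen (pot a b V) ψ x ^ 2 / wt a b x - ∑ i, pd i ψ x ^ 2)
      * Real.exp (-pot a b V x) := by
  have hU := contDiff_pot (a := a) (b := b) hV
  have hρ := continuous_density (a := a) (b := b) hV
  have hζ : ContDiff ℝ ∞ fun x : Euc n => fzeta a b (‖x‖ ^ 2) := contDiff_radial contDiff_fzeta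
  have hL := (contDiff_gen hU hψ).continuous
  have hd := fun i => (contDiff_pd hψ i).continuous
  have hdd := fun i j => (contDiff_pd (contDiff_pd hψ j) i).continuous
  have hUd := fun i j => (contDiff_pd (contDiff_pd hU j) i).continuous
  have hζd := fun i => (contDiff_pd hζ i).continuous
  have hζdd := fun i j => (contDiff_pd (contDiff_pd hζ j) i).continuous
  have hζ0 := hζ.continuous
  have hw := (contDiff_wt (n := n) (a := a) (b := b)).continuous
  have hb := bochner hU hψ hc hζ
  refine (?_ : (0 : ℝ) ≤ _).trans_eq
    ((integral_sub ?_ ?_).trans ((congrArg _ hb).trans (sub_zero _)))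
  · refine integral_nonneg fun x => ?_
    simp only [Pi.zero_apply]
    rw [← sub_mul]
    refine mul_nonneg ?_ (Real.exp_pos _).le
    rw [sum_pd_radial (hasDerivAt_fzeta ha _), hessian_pot hV,
      sum_pd_pd_radial (fun s => hasDerivAt_fzeta ha s)
        (contDiff_const.mul (((contDiff_const.mul contDiff_fsig).mul contDiff_fzeta).sub
          contDiff_const)) (hasDerivAt_fzeta_deriv ha _)]
    have hwp := wt_pos (b := b) ha x
    have h1 := fzeta_nonneg (b := b) ha (‖x‖ ^ 2)
    have h2 : wt a b x * fzeta a b (‖x‖ ^ 2) ≤ 1 := fsig_mul_fzeta_le ha _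
    have h3 := hconv x fun i => pd i ψ x
    have h4 : 0 ≤ ∑ i, ∑ j, pd i (pd j ψ) x ^ 2 :=
      Finset.sum_nonneg fun i _ => Finset.sum_nonneg fun j _ => sq_nonneg _
    have h5 : 0 ≤ (1 - wt a b x * fzeta a b (‖x‖ ^ 2)) / wt a b x
        * (gen (pot a b V) ψ x + wt a b x * ∑ i, x i * pd i ψ x) ^ 2 :=
      mul_nonneg (div_nonneg (sub_nonneg.2 h2) hwp.le) (sq_nonneg _)
    have h6 := mul_nonneg h1 (add_nonneg h3 h4)
    refine (add_nonneg h5 h6).trans (le_of_eq ?_)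
    change _ = _ / _ - _ - (_ + _ * (2 * (1 / 2 * (wt a b x * _ - 1)) * _) - _
      - fzeta a b (‖x‖ ^ 2) * _ + (2 * (1 / 2 * (wt a b x * _ - 1)) * _ +
        4 * (1 / 4 * (bt a b x * _ - wt a b x * (1 - wt a b x * _))) * _))
    field_simp
    ring
  · refine integrable_of_vanish (u := ψ) ?_ hc ?_
    · exact (((hL.pow 2).div hw fun x => (wt_pos ha x).ne').sub
        (continuous_finsetSum _ fun i _ => (hd i).pow 2)).mul hρ
    · intro x hx; simp [gen_eq_zero _ hx, pd_eq_zero hx]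
  · refine integrable_of_vanish (u := ψ) ?_ hc ?_
    · fun_prop
    · intro x hx; simp [gen_eq_zero _ hx, pd_eq_zero hx, pd_pd_eq_zero hx]

lemma pot_neg (heven : ∀ x, V (-x) = V x) (x : Euc n) : pot a b V (-x) = pot a b V x := by
  simp [pot, heven]

lemma integral_odd_eq_zero {f : Euc n → ℝ} (h : ∀ x, f (-x) = -f x) : ∫ x, f x = 0 := by
  have := integral_neg_eq_self f (volume : Measure (Euc n))
  simp_rw [h, integral_neg] at this
  linarith

/-- The weighted Poincaré inequality for odd functions. -/
lemma odd_poincare (ha : 0 < a) (hV : ContDiff ℝ ∞ V) (heven : ∀ x, V (-x) = V x)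
    (hconv : ∀ x (v : Fin n → ℝ), 0 ≤ ∑ i, ∑ j, pd i (pd j V) x * v i * v j)
    {φ : Euc n → ℝ} (hφ : ContDiff ℝ ∞ φ) (hc : HasCompactSupport φ)
    (hodd : ∀ x, φ (-x) = -φ x) :
    0 ≤ ∫ x, (∑ i, pd i φ x ^ 2 - wt a b x * φ x ^ 2) * Real.exp (-pot a b V x) := by
  have hU := contDiff_pot (a := a) (b := b) hV
  have hρ := continuous_density (a := a) (b := b) hV
  have hw := (contDiff_wt (n := n) (a := a) (b := b)).continuous
  have hw0 : ∀ x : Euc n, wt a b x ≠ 0 := fun x => (wt_pos ha x).ne'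
  have hφ0 := hφ.continuous
  have hφd := fun i => (contDiff_pd hφ i).continuous
  refine le_of_forall_pos_lt_add fun ε hε => ?_
  obtain ⟨ψ, hψ, hψc, herr⟩ := exists_gen_approx (k := fun x => wt a b x * φ x) hU hw
    (mul_pos (by positivity) (fsig_pos (a := a) (b := b) 0)) (wt_ge ha) (hw.mul hφ0)
    (integrable_of_vanish (u := φ) (by fun_prop (disch := assumption)) hc
      fun x hx => by simp [image_eq_zero_of_notMem_tsupport hx])
    (integral_odd_eq_zero fun x => by rw [wt_neg, hodd, pot_neg heven]; ring) hε
  have hψd := fun i => (contDiff_pd hψ i).continuous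
  have hL := (contDiff_gen hU hψ).continuous
  have hA := energy_le_gen (b := b) ha hV hconv hψ hψc
  have hI := integral_mul_gen hU hψ hψc hφ
  have i1 : Integrable fun x => (∑ i, pd i φ x ^ 2 - wt a b x * φ x ^ 2)
      * Real.exp (-pot a b V x) :=
    integrable_of_vanish (u := φ) (by fun_prop) hc
      fun x hx => by simp [image_eq_zero_of_notMem_tsupport hx, pd_eq_zero hx]
  have i2 : Integrable fun x => (gen (pot a b V) ψ x - wt a b x * φ x) ^ 2 / wt a b x
      * Real.exp (-pot a b V x) := by
    refine integrable_of_compact (by fun_prop (disch := assumption)) ?_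
    have : HasCompactSupport fun x => gen (pot a b V) ψ x - wt a b x * φ x :=
      (hasCompactSupport_gen _ hψc).sub hc.mul_left
    exact HasCompactSupport.intro this fun x hx => by
      rw [image_eq_zero_of_notMem_tsupport (f := fun x => gen (pot a b V) ψ x - wt a b x * φ x) hx]
      simp
  have i3 : Integrable fun x => (φ x * gen (pot a b V) ψ x + ∑ i, pd i φ x * pd i ψ x)
      * Real.exp (-pot a b V x) :=
    integrable_of_vanish (u := φ) (by fun_prop) hc
      fun x hx => by simp [image_eq_zero_of_notMem_tsupport hx, pd_eq_zero hx]
  have i4 : Integrable fun x => (gen (pot a b V) ψ x ^ 2 / wt a b x - ∑ i, pd i ψ x ^ 2)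
      * Real.exp (-pot a b V x) :=
    integrable_of_vanish (u := ψ) (by fun_prop (disch := assumption)) hψc
      fun x hx => by simp [gen_eq_zero _ hx, pd_eq_zero hx]
  have key : 0 ≤ ∫ x, (((∑ i, pd i φ x ^ 2 - wt a b x * φ x ^ 2) * Real.exp (-pot a b V x)
      + (gen (pot a b V) ψ x - wt a b x * φ x) ^ 2 / wt a b x * Real.exp (-pot a b V x))
      + 2 * ((φ x * gen (pot a b V) ψ x + ∑ i, pd i φ x * pd i ψ x) * Real.exp (-pot a b V x)))
      - (gen (pot a b V) ψ x ^ 2 / wt a b x - ∑ i, pd i ψ x ^ 2) * Real.exp (-pot a b V x) := by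
    refine integral_nonneg fun x => ?_
    have e : ∑ i, (pd i φ x + pd i ψ x) ^ 2 =
        ∑ i, pd i φ x ^ 2 + 2 * ∑ i, pd i φ x * pd i ψ x + ∑ i, pd i ψ x ^ 2 := by
      rw [Finset.mul_sum, ← Finset.sum_add_distrib, ← Finset.sum_add_distrib]
      exact Finset.sum_congr rfl fun i _ => by ring
    have h : 0 ≤ (∑ i, (pd i φ x + pd i ψ x) ^ 2) * Real.exp (-pot a b V x) := by positivity
    refine h.trans (le_of_eq ?_)
    rw [e]
    have := hw0 x
    field_simp
    ring
  rw [integral_comb i1 i2 i3 i4, hI] at key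
  linarith

end Potential

section Variance

lemma integrable_gaussian {c : ℝ} (hc : 0 < c) :
    Integrable fun x : Euc n => Real.exp (-c * ‖x‖ ^ 2) := by
  have h := (GaussianFourier.integrable_cexp_neg_mul_sq_norm_add (V := Euc n) (b := (c : ℂ))
    (by simpa using hc) 0 0).re
  refine h.congr (Eventually.of_forall fun x => ?_)
  simp only [inner_zero_left, Complex.ofReal_zero, mul_zero, add_zero]
  rw [show (-(c : ℂ) * (‖x‖ : ℂ) ^ 2) = ((-c * ‖x‖ ^ 2 : ℝ) : ℂ) by push_cast; ring,
    ← Complex.ofReal_exp]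
  rfl

lemma sq_one_add_le_exp {s : ℝ} (hs : 0 ≤ s) : (1 + s) ^ 2 ≤ 8 * Real.exp (s / 2) := by
  have := Real.quadratic_le_exp_of_nonneg (by positivity : 0 ≤ s / 2)
  nlinarith

variable {a b : ℝ} {V : Euc n → ℝ}

lemma density_le {c₀ : ℝ} (hbdd : ∀ x, c₀ ≤ V x) (x : Euc n) :
    Real.exp (-pot a b V x) ≤ Real.exp (-c₀) * (Real.exp (-b) * Real.exp (-a * ‖x‖ ^ 2)) := by
  rw [pot, neg_add_rev, Real.exp_add]
  exact mul_le_mul (Real.exp_le_exp.2 (neg_le_neg (hbdd x))) (exp_neg_fW_le _)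
    (Real.exp_pos _).le (Real.exp_pos _).le

lemma integrable_mul_density (ha : 0 < a) (hV : Continuous V) {c₀ : ℝ} (hbdd : ∀ x, c₀ ≤ V x)
    {f : Euc n → ℝ} (hf : Continuous f) {C : ℝ}
    (hb : ∀ x, |f x| ≤ C * (1 + a * ‖x‖ ^ 2) ^ 2) :
    Integrable fun x => f x * Real.exp (-pot a b V x) := by
  have hC : 0 ≤ C := by
    have := (abs_nonneg _).trans (hb 0)
    simpa using this
  have hpot : Continuous (pot a b V) :=
    (contDiff_radial (n := n) (contDiff_fW (a := a) (b := b))).continuous.add hV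
  refine ((integrable_gaussian (n := n) (half_pos ha)).const_mul
    (C * 8 * Real.exp (-c₀) * Real.exp (-b))).mono' (by fun_prop)
    (Eventually.of_forall fun x => ?_)
  rw [norm_mul, Real.norm_eq_abs, Real.norm_of_nonneg (Real.exp_pos _).le]
  have e : Real.exp (-(a / 2) * ‖x‖ ^ 2) =
      Real.exp (a * ‖x‖ ^ 2 / 2) * Real.exp (-a * ‖x‖ ^ 2) := by
    rw [← Real.exp_add]; ring_nf
  calc |f x| * Real.exp (-pot a b V x)
      ≤ (C * (8 * Real.exp (a * ‖x‖ ^ 2 / 2))) *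
        (Real.exp (-c₀) * (Real.exp (-b) * Real.exp (-a * ‖x‖ ^ 2))) := by
        refine mul_le_mul ((hb x).trans ?_) (density_le hbdd x) (Real.exp_pos _).le (by positivity)
        exact mul_le_mul_of_nonneg_left (sq_one_add_le_exp (by positivity)) hC
    _ = _ := by rw [e]; ring

lemma gen_comp_neg {U u : Euc n → ℝ} (hU : ContDiff ℝ ∞ U) (heven : ∀ x, U (-x) = U x)
    (hu : ContDiff ℝ ∞ u) (x : Euc n) : gen U (fun x => u (-x)) x = gen U u (-x) := by
  unfold gen
  refine Finset.sum_congr rfl fun i _ => ?_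
  have h1 : pd i (fun x => u (-x)) = fun x => -1 * pd i u (-x) := by
    ext y; rw [pd_comp_neg hu]; ring
  have h2 : pd i U x = -pd i U (-x) := by
    rw [← pd_comp_neg hU]; congr 1; ext y; exact (heven y).symm
  have h3 : ContDiff ℝ ∞ fun x => pd i u (-x) := (contDiff_pd hu i).comp contDiff_neg
  rw [h1, pd_const_mul h3, pd_comp_neg (contDiff_pd hu i), h2]
  ring

lemma hasCompactSupport_comp_neg {u : Euc n → ℝ} (hu : HasCompactSupport u) :
    HasCompactSupport fun x => u (-x) :=
  hu.comp_homeomorph (Homeomorph.neg (Euc n))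

lemma exists_even_gen_approx {U k : Euc n → ℝ} (hU : ContDiff ℝ ∞ U) (heven : ∀ x, U (-x) = U x)
    (hk : Continuous k) (hkeven : ∀ x, k (-x) = k x)
    (hk2 : Integrable fun x => k x ^ 2 * Real.exp (-U x))
    (hk0 : ∫ x, k x * Real.exp (-U x) = 0) {ε : ℝ} (hε : 0 < ε) :
    ∃ u : Euc n → ℝ, ContDiff ℝ ∞ u ∧ HasCompactSupport u ∧ (∀ x, u (-x) = u x) ∧
      ∫ x, (gen U u x - k x) ^ 2 * Real.exp (-U x) < ε := by
  obtain ⟨v, hv, hvc, herr⟩ := exists_gen_approx (w := fun _ => 1) (k := k) hU continuous_const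
    one_pos (fun _ => le_rfl) hk (by simpa using hk2) hk0 hε
  simp only [div_one] at herr
  have hv' : ContDiff ℝ ∞ fun x => v (-x) := hv.comp contDiff_neg
  have hL := (contDiff_gen hU hv).continuous
  have hρ := (contDiff_density hU).continuous
  have hg : ∀ x, gen U (fun x => 1 / 2 * (v x + v (-x))) x =
      1 / 2 * (gen U v x + gen U v (-x)) := by
    intro x
    rw [gen_const_mul U (hv.add hv'), gen_add U hv hv', gen_comp_neg hU heven hv]
  have i1 : Integrable fun x => (gen U v x - k x) ^ 2 * Real.exp (-U x) := by
    have h : Integrable fun x => (gen U v x ^ 2 - 2 * gen U v x * k x) * Real.exp (-U x) :=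
      integrable_of_vanish (u := v) (by fun_prop) hvc fun x hx => by simp [gen_eq_zero _ hx]
    exact (h.add hk2).congr (Eventually.of_forall fun x => by simp only [Pi.add_apply]; ring)
  have i2 : Integrable fun x => (gen U v (-x) - k x) ^ 2 * Real.exp (-U x) := by
    refine (i1.comp_neg).congr (Eventually.of_forall fun x => ?_)
    simp only [hkeven, heven]
  have e2 : ∫ x, (gen U v (-x) - k x) ^ 2 * Real.exp (-U x) =
      ∫ x, (gen U v x - k x) ^ 2 * Real.exp (-U x) := by
    rw [← integral_neg_eq_self (fun x => (gen U v x - k x) ^ 2 * Real.exp (-U x))]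
    simp only [hkeven, heven]
  refine ⟨fun x => 1 / 2 * (v x + v (-x)), contDiff_const.mul (hv.add hv'),
    (hvc.add (hasCompactSupport_comp_neg hvc)).mul_left, fun x => by simp [add_comm], ?_⟩
  refine lt_of_le_of_lt ?_ herr
  calc _ ≤ ∫ x, (1 / 2 * ((gen U v x - k x) ^ 2 * Real.exp (-U x))
        + 1 / 2 * ((gen U v (-x) - k x) ^ 2 * Real.exp (-U x))) := by
        refine integral_mono_of_nonneg (Eventually.of_forall fun x => by positivity)
          ((i1.const_mul _).add (i2.const_mul _)) (Eventually.of_forall fun x => ?_)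
        simp only [hg]
        have hx := Real.exp_pos (-U x)
        have : 0 ≤ (gen U v x - gen U v (-x)) ^ 2 * Real.exp (-U x) := by positivity
        linarith
    _ = _ := by
        rw [integral_add (i1.const_mul _) (i2.const_mul _), integral_const_mul,
          integral_const_mul, e2]
        ring

/-- The derivative in `t` of the radial potential. -/
noncomputable def hfun (a b : ℝ) (x : Euc n) : ℝ := wt a b x * ‖x‖ ^ 2

/-- The second derivative in `t` of the radial potential. -/
noncomputable def qfun (a b : ℝ) (x : Euc n) : ℝ :=
  2 * wt a b x * ‖x‖ ^ 2 + bt a b x * (‖x‖ ^ 2) ^ 2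

lemma contDiff_hfun : ContDiff ℝ ∞ (hfun a b : Euc n → ℝ) := contDiff_wt.mul (contDiff_norm_sq ℝ)

lemma contDiff_qfun : ContDiff ℝ ∞ (qfun a b : Euc n → ℝ) :=
  ((contDiff_const.mul contDiff_wt).mul (contDiff_norm_sq ℝ)).add
    (contDiff_bt.mul ((contDiff_norm_sq ℝ).pow 2))

lemma hfun_nonneg (ha : 0 < a) (x : Euc n) : 0 ≤ hfun a b x :=
  mul_nonneg (wt_pos ha x).le (by positivity)

lemma hfun_le (ha : 0 < a) (x : Euc n) : hfun a b x ≤ 2 * (1 + a * ‖x‖ ^ 2) := by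
  have := mul_le_mul_of_nonneg_right (wt_le (b := b) ha x) (sq_nonneg ‖x‖)
  unfold hfun; linarith

lemma qfun_nonneg (ha : 0 < a) (x : Euc n) : 0 ≤ qfun a b x := by
  have := (wt_pos (b := b) ha x).le
  have := bt_nonneg (a := a) (b := b) x
  unfold qfun; positivity

lemma qfun_le (ha : 0 < a) (x : Euc n) : qfun a b x ≤ 4 * (1 + a * ‖x‖ ^ 2) ^ 2 := by
  have h1 := mul_le_mul_of_nonneg_right (wt_le (b := b) ha x) (sq_nonneg ‖x‖)
  have h2 := mul_le_mul_of_nonneg_right (bt_le (a := a) (b := b) x) (sq_nonneg (‖x‖ ^ 2))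
  have h3 : 0 ≤ a * ‖x‖ ^ 2 := by positivity
  unfold qfun; nlinarith

lemma pd_hfun_sub (m : ℝ) (i : Fin n) (x : Euc n) :
    pd i (fun x => hfun a b x - m) x = (2 * wt a b x + bt a b x * ‖x‖ ^ 2) * x i := by
  have h : HasDerivAt (fun s => 2 * a * fsig a b s * s - m) _ (‖x‖ ^ 2) :=
    ((((hasDerivAt_fsig (a := a) (b := b) (‖x‖ ^ 2)).const_mul (2 * a)).mul
      (hasDerivAt_id _)).sub_const m)
  refine (pd_radial h i).trans ?_
  simp only [wt, bt, id]
  ring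

lemma poincare_gradient (ha : 0 < a) (hV : ContDiff ℝ ∞ V) (heven : ∀ x, V (-x) = V x)
    (hconv : ∀ x (v : Fin n → ℝ), 0 ≤ ∑ i, ∑ j, pd i (pd j V) x * v i * v j)
    {u : Euc n → ℝ} (hu : ContDiff ℝ ∞ u) (hc : HasCompactSupport u) (hueven : ∀ x, u (-x) = u x) :
    0 ≤ ∫ x, (gen (pot a b V) u x ^ 2 - 2 * wt a b x * (∑ i, pd i u x ^ 2)
      - bt a b x * (∑ i, x i * pd i u x) ^ 2) * Real.exp (-pot a b V x) := by
  have hU := contDiff_pot (a := a) (b := b) hV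
  have hρ := continuous_density (a := a) (b := b) hV
  have hL := (contDiff_gen hU hu).continuous
  have hd := fun i => (contDiff_pd hu i).continuous
  have hdd := fun i j => (contDiff_pd (contDiff_pd hu j) i).continuous
  have hUd := fun i j => (contDiff_pd (contDiff_pd hU j) i).continuous
  have hw := (contDiff_wt (n := n) (a := a) (b := b)).continuous
  have hbt := (contDiff_bt (n := n) (a := a) (b := b)).continuous
  have hodd : ∀ j x, pd j u (-x) = -pd j u x := by
    intro j x
    have := pd_comp_neg hu j x
    simp_rw [hueven] at this
    change pd j u x = _ at this
    linarith
  have hP : 0 ≤ ∑ j, ∫ x, (∑ i, pd i (pd j u) x ^ 2 - wt a b x * pd j u x ^ 2)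
      * Real.exp (-pot a b V x) :=
    Finset.sum_nonneg fun j _ => odd_poincare ha hV heven hconv (contDiff_pd hu j)
      (hasCompactSupport_pd hc j) (hodd j)
  rw [← integral_finsetSum _ fun j _ => ?_] at hP
  · have hB := bochner hU hu hc (contDiff_const (c := (1 : ℝ)))
    have hz : ∀ i : Fin n, pd i (fun _ : Euc n => (1 : ℝ)) = fun _ => 0 := by
      intro i; ext x; simp [pd]
    have hz' : ∀ i : Fin n, pd i (fun _ : Euc n => (0 : ℝ)) = fun _ => 0 := by
      intro i; ext x; simp [pd]
    simp only [hz, hz', zero_mul, Finset.sum_const_zero, mul_zero, add_zero, one_mul] at hB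
    have iP : Integrable fun x => ∑ j, (∑ i, pd i (pd j u) x ^ 2 - wt a b x * pd j u x ^ 2)
        * Real.exp (-pot a b V x) :=
      integrable_of_vanish (u := u) (by fun_prop) hc fun x hx => by
        simp [pd_eq_zero hx, pd_pd_eq_zero hx]
    have iB : Integrable fun x => (gen (pot a b V) u x ^ 2 - ∑ i, ∑ j, pd i (pd j u) x ^ 2
        - ∑ i, ∑ j, pd i (pd j (pot a b V)) x * pd i u x * pd j u x) * Real.exp (-pot a b V x) :=
      integrable_of_vanish (u := u) (by fun_prop) hc fun x hx => by
        simp [pd_eq_zero hx, pd_pd_eq_zero hx, gen_eq_zero _ hx]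
    have hs := integral_add iP iB
    rw [hB, add_zero] at hs
    rw [← hs] at hP
    refine hP.trans (integral_mono (iP.add iB) ?_ fun x => ?_)
    · exact integrable_of_vanish (u := u) (by fun_prop) hc fun x hx => by
        simp [pd_eq_zero hx, gen_eq_zero _ hx]
    · rw [← Finset.sum_mul, ← add_mul]
      refine mul_le_mul_of_nonneg_right ?_ (Real.exp_pos _).le
      have h3 := hconv x fun i => pd i u x
      rw [hessian_pot hV, Finset.sum_sub_distrib, ← Finset.mul_sum,
        Finset.sum_comm (f := fun j i => pd i (pd j u) x ^ 2)]
      linarith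
  · exact integrable_of_vanish (u := u) (by fun_prop) hc fun x hx => by
      simp [pd_eq_zero hx, pd_pd_eq_zero hx]

/-- The variance inequality. -/
lemma variance_le (ha : 0 < a) (hV : ContDiff ℝ ∞ V) (heven : ∀ x, V (-x) = V x)
    (hconv : ∀ x (v : Fin n → ℝ), 0 ≤ ∑ i, ∑ j, pd i (pd j V) x * v i * v j)
    {c₀ : ℝ} (hbdd : ∀ x, c₀ ≤ V x) {m : ℝ}
    (hm : ∫ x, (hfun a b x - m) * Real.exp (-pot a b V x) = 0) :
    0 ≤ ∫ x, (qfun a b x - (hfun a b x - m) ^ 2) * Real.exp (-pot a b V x) := by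
  have hU := contDiff_pot (a := a) (b := b) hV
  have hρ := continuous_density (a := a) (b := b) hV
  have hw := (contDiff_wt (n := n) (a := a) (b := b)).continuous
  have hbt := (contDiff_bt (n := n) (a := a) (b := b)).continuous
  have hh := (contDiff_hfun (n := n) (a := a) (b := b)).continuous
  have hq := (contDiff_qfun (n := n) (a := a) (b := b)).continuous
  have hk2 : Integrable fun x => (hfun a b x - m) ^ 2 * Real.exp (-pot a b V x) := by
    refine integrable_mul_density ha hV.continuous hbdd ((hh.sub continuous_const).pow 2)
      (C := (2 + |m|) ^ 2) fun x => ?_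
    rw [abs_pow, ← mul_pow]
    refine pow_le_pow_left₀ (abs_nonneg _) ?_ 2
    have h1 := hfun_le (b := b) ha x
    have h2 : 0 ≤ |m| * (a * ‖x‖ ^ 2) := by positivity
    refine (abs_sub _ _).trans ?_
    rw [abs_of_nonneg (hfun_nonneg ha x)]
    linarith
  have iq : Integrable fun x => qfun a b x * Real.exp (-pot a b V x) := by
    refine integrable_mul_density ha hV.continuous hbdd hq (C := 4) fun x => ?_
    rw [abs_of_nonneg (qfun_nonneg ha x)]
    exact qfun_le ha x
  have i1 : Integrable fun x => (qfun a b x - (hfun a b x - m) ^ 2) * Real.exp (-pot a b V x) :=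
    (iq.sub hk2).congr (Eventually.of_forall fun x => by simp only [Pi.sub_apply]; ring)
  refine le_of_forall_pos_lt_add fun ε hε => ?_
  obtain ⟨u, hu, hc, hueven, herr⟩ := exists_even_gen_approx
    (k := fun x => hfun a b x - m) hU (pot_neg heven)
    (hh.sub continuous_const) (fun x => by simp [hfun, wt_neg]) hk2 hm hε
  have hL := (contDiff_gen hU hu).continuous
  have hd := fun i => (contDiff_pd hu i).continuous
  have hI := integral_mul_gen hU hu hc
    ((contDiff_hfun (n := n) (a := a) (b := b)).sub (contDiff_const (c := m)))
  simp only [pd_hfun_sub] at hI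
  have hP := poincare_gradient (b := b) ha hV heven hconv hu hc hueven
  have i2 : Integrable fun x => (gen (pot a b V) u x - (hfun a b x - m)) ^ 2
      * Real.exp (-pot a b V x) := by
    have h : Integrable fun x => (gen (pot a b V) u x ^ 2 -
        2 * gen (pot a b V) u x * (hfun a b x - m)) * Real.exp (-pot a b V x) :=
      integrable_of_vanish (u := u) (by fun_prop) hc fun x hx => by simp [gen_eq_zero _ hx]
    exact (h.add hk2).congr (Eventually.of_forall fun x => by simp only [Pi.add_apply]; ring)
  have i3 : Integrable fun x => ((hfun a b x - m) * gen (pot a b V) u x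
      + ∑ i, (2 * wt a b x + bt a b x * ‖x‖ ^ 2) * x i * pd i u x) * Real.exp (-pot a b V x) :=
    integrable_of_vanish (u := u) (by fun_prop) hc fun x hx => by
      simp [pd_eq_zero hx, gen_eq_zero _ hx]
  have i4 : Integrable fun x => (gen (pot a b V) u x ^ 2 - 2 * wt a b x * (∑ i, pd i u x ^ 2)
      - bt a b x * (∑ i, x i * pd i u x) ^ 2) * Real.exp (-pot a b V x) :=
    integrable_of_vanish (u := u) (by fun_prop) hc fun x hx => by
      simp [pd_eq_zero hx, gen_eq_zero _ hx]
  have key : 0 ≤ ∫ x, ((qfun a b x - (hfun a b x - m) ^ 2) * Real.exp (-pot a b V x)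
      + (gen (pot a b V) u x - (hfun a b x - m)) ^ 2 * Real.exp (-pot a b V x)
      + 2 * (((hfun a b x - m) * gen (pot a b V) u x
      + ∑ i, (2 * wt a b x + bt a b x * ‖x‖ ^ 2) * x i * pd i u x) * Real.exp (-pot a b V x))
      - (gen (pot a b V) u x ^ 2 - 2 * wt a b x * (∑ i, pd i u x ^ 2)
      - bt a b x * (∑ i, x i * pd i u x) ^ 2) * Real.exp (-pot a b V x)) := by
    refine integral_nonneg fun x => ?_
    have e : ∑ i, (x i + pd i u x) ^ 2 =
        ‖x‖ ^ 2 + 2 * ∑ i, x i * pd i u x + ∑ i, pd i u x ^ 2 := by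
      rw [← sum_sq_coord, Finset.mul_sum, ← Finset.sum_add_distrib, ← Finset.sum_add_distrib]
      exact Finset.sum_congr rfl fun i _ => by ring
    have h1 := (wt_pos (b := b) ha x).le
    have h2 := bt_nonneg (a := a) (b := b) x
    have h : 0 ≤ (2 * wt a b x * (∑ i, (x i + pd i u x) ^ 2)
        + bt a b x * (‖x‖ ^ 2 + ∑ i, x i * pd i u x) ^ 2) * Real.exp (-pot a b V x) := by
      positivity
    refine h.trans (le_of_eq ?_)
    simp_rw [mul_assoc _ (x.ofLp _) (pd _ u x), ← Finset.mul_sum]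
    rw [e]
    simp only [qfun]
    ring
  rw [integral_comb i1 i2 i3 i4, hI] at key
  linarith

end Variance

section Dilation

variable {a b : ℝ} {V : Euc n → ℝ}

lemma continuous_pot (hV : Continuous V) : Continuous (pot a b V) :=
  (contDiff_radial (n := n) (contDiff_fW (a := a) (b := b))).continuous.add hV

lemma abs_mul_density_le (ha : 0 < a) {c₀ : ℝ} (hbdd : ∀ x, c₀ ≤ V x) {y C : ℝ} {x : Euc n}
    (hy : |y| ≤ C * (1 + a * ‖x‖ ^ 2) ^ 2) :
    |y * Real.exp (-pot a b V x)| ≤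
      C * 8 * Real.exp (-c₀) * Real.exp (-b) * Real.exp (-(a / 2) * ‖x‖ ^ 2) := by
  have hC : 0 ≤ C := by
    have h1 := (abs_nonneg _).trans hy
    have h2 : 0 < (1 + a * ‖x‖ ^ 2) ^ 2 := by positivity
    exact nonneg_of_mul_nonneg_left h1 h2
  rw [abs_mul, abs_of_nonneg (Real.exp_pos (-pot a b V x)).le]
  have e : Real.exp (-(a / 2) * ‖x‖ ^ 2) =
      Real.exp (a * ‖x‖ ^ 2 / 2) * Real.exp (-a * ‖x‖ ^ 2) := by
    rw [← Real.exp_add]; ring_nf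
  calc |y| * Real.exp (-pot a b V x)
      ≤ (C * (8 * Real.exp (a * ‖x‖ ^ 2 / 2))) *
        (Real.exp (-c₀) * (Real.exp (-b) * Real.exp (-a * ‖x‖ ^ 2))) := by
        refine mul_le_mul (hy.trans ?_) (density_le hbdd x) (Real.exp_pos _).le (by positivity)
        exact mul_le_mul_of_nonneg_left (sq_one_add_le_exp (by positivity)) hC
    _ = _ := by rw [e]; ring

lemma integral_lin {f g h : Euc n → ℝ} (hf : Integrable f) (hg : Integrable g)
    (hh : Integrable h) (p q r : ℝ) :
    ∫ x, (p * f x + q * g x + r * h x) =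
      p * (∫ x, f x) + q * (∫ x, g x) + r * ∫ x, h x := by
  have h2 := integral_add ((hf.const_mul p).add (hg.const_mul q)) (hh.const_mul r)
  have h3 := integral_add (hf.const_mul p) (hg.const_mul q)
  simp only [Pi.add_apply] at h2
  rw [h2, h3, integral_const_mul, integral_const_mul, integral_const_mul]

section Flow

variable (k : ℝ)

/-- The scale parameter along the dilation flow. -/
noncomputable def scale (t : ℝ) : ℝ := k * Real.exp (2 * t)

variable {k}

lemma scale_pos (hk : 0 < k) (t : ℝ) : 0 < scale k t := by unfold scale; positivity

lemma hasDerivAt_scale (t : ℝ) : HasDerivAt (scale k) (2 * scale k t) t := by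
  have h := ((((hasDerivAt_id t).const_mul 2).exp).const_mul k)
  refine (show HasDerivAt (scale k) _ t from h).congr_deriv ?_
  simp [scale]; ring

lemma scale_mono (hk : 0 < k) {s t : ℝ} (h : s ≤ t) : scale k s ≤ scale k t :=
  mul_le_mul_of_nonneg_left (Real.exp_le_exp.2 (by linarith)) hk.le

lemma fW_eq (a b s : ℝ) : fW a b s = fW 1 0 (a * s + b) := by simp [fW]

lemma fsig_eq (a b s : ℝ) : fsig a b s = fsig 1 0 (a * s + b) := by simp [fsig]

lemma hasDerivAt_scale_mul (s t : ℝ) :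
    HasDerivAt (fun t => scale k t * s + b) (2 * scale k t * s) t :=
  ((hasDerivAt_scale t).mul_const s).add_const b

lemma hasDerivAt_density (t : ℝ) (x : Euc n) :
    HasDerivAt (fun t => Real.exp (-pot (scale k t) b V x))
      (-hfun (scale k t) b x * Real.exp (-pot (scale k t) b V x)) t := by
  have h1 : HasDerivAt (fun t => pot (scale k t) b V x) (hfun (scale k t) b x) t := by
    have h := (((hasDerivAt_fW (a := 1) (b := 0) _).comp t
      (hasDerivAt_scale_mul (b := b) (k := k) (‖x‖ ^ 2) t)).add_const (V x))
    simp only [Function.comp_def, ← fW_eq, ← fsig_eq] at h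
    exact h.congr_deriv (by simp only [hfun, wt]; ring)
  exact h1.fun_neg.exp.congr_deriv (by ring)

lemma hasDerivAt_hfun (t : ℝ) (x : Euc n) :
    HasDerivAt (fun t => hfun (scale k t) b x) (qfun (scale k t) b x) t := by
  have h := ((((hasDerivAt_scale (k := k) t).const_mul 2).mul
    ((hasDerivAt_fsig (a := 1) (b := 0) _).comp t
      (hasDerivAt_scale_mul (b := b) (k := k) (‖x‖ ^ 2) t))).mul_const (‖x‖ ^ 2))
  simp only [Function.comp_def, ← fsig_eq] at h
  exact h.congr_deriv (by simp only [qfun, wt, bt]; ring)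

lemma hasDerivAt_hfun_density (t : ℝ) (x : Euc n) :
    HasDerivAt (fun t => -hfun (scale k t) b x * Real.exp (-pot (scale k t) b V x))
      ((hfun (scale k t) b x ^ 2 - qfun (scale k t) b x) *
        Real.exp (-pot (scale k t) b V x)) t :=
  ((hasDerivAt_hfun t x).fun_neg.mul (hasDerivAt_density t x)).congr_deriv (by ring)

lemma abs_hfun_le (ha : 0 < a) (x : Euc n) : |-hfun a b x| ≤ 2 * (1 + a * ‖x‖ ^ 2) ^ 2 := by
  rw [abs_neg, abs_of_nonneg (hfun_nonneg ha x)]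
  have := hfun_le (b := b) ha x
  have h3 : 0 ≤ a * ‖x‖ ^ 2 := by positivity
  nlinarith

lemma abs_hfun_sq_sub_le (ha : 0 < a) (x : Euc n) :
    |hfun a b x ^ 2 - qfun a b x| ≤ 8 * (1 + a * ‖x‖ ^ 2) ^ 2 := by
  have h1 := hfun_le (b := b) ha x
  have h2 := hfun_nonneg (b := b) ha x
  have h3 := qfun_le (b := b) ha x
  have h4 := qfun_nonneg (b := b) ha x
  rw [abs_le]
  constructor <;> nlinarith

/-- Differentiation under the integral sign along the flow. -/
lemma hasDerivAt_integral_flow (hk : 0 < k) {c₀ : ℝ} (hbdd : ∀ x, c₀ ≤ V x)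
    (hV : Continuous V) {g g' : ℝ → Euc n → ℝ} {C : ℝ} (hg : ∀ t, Continuous (g t))
    (hg' : ∀ t, Continuous (g' t))
    (hbg : ∀ t x, |g t x| ≤ C * (1 + scale k t * ‖x‖ ^ 2) ^ 2)
    (hb : ∀ t x, |g' t x| ≤ C * (1 + scale k t * ‖x‖ ^ 2) ^ 2)
    (hd : ∀ t x, HasDerivAt (fun t => g t x * Real.exp (-pot (scale k t) b V x))
      (g' t x * Real.exp (-pot (scale k t) b V x)) t) (t : ℝ) :
    HasDerivAt (fun t => ∫ x, g t x * Real.exp (-pot (scale k t) b V x))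
      (∫ x, g' t x * Real.exp (-pot (scale k t) b V x)) t := by
  have hC : 0 ≤ C := by
    have := (abs_nonneg _).trans (hb 0 0)
    simpa using this
  refine (hasDerivAt_integral_of_dominated_loc_of_deriv_le (Metric.ball_mem_nhds t one_pos)
    (bound := fun x => C * 8 * Real.exp (-c₀) * Real.exp (-b) *
      Real.exp (-(scale k (t - 1) / 2) * ‖x‖ ^ 2))
    (Eventually.of_forall fun s => ?_) ?_ ?_ (Eventually.of_forall fun x s hs => ?_) ?_
    (Eventually.of_forall fun x s _ => hd s x)).2
  · exact ((hg s).mul (continuous_pot hV).neg.rexp).aestronglyMeasurable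
  · exact integrable_mul_density (scale_pos hk t) hV hbdd (hg t) (hbg t)
  · exact ((hg' t).mul (continuous_pot hV).neg.rexp).aestronglyMeasurable
  · refine (abs_mul_density_le (scale_pos hk s) hbdd (hb s x)).trans ?_
    refine mul_le_mul_of_nonneg_left (Real.exp_le_exp.2 ?_) (by positivity)
    have h1 : t - 1 ≤ s := by
      rw [Metric.mem_ball, Real.dist_eq, abs_lt] at hs; linarith
    have := mul_le_mul_of_nonneg_right (scale_mono hk h1) (sq_nonneg ‖x‖)
    linarith
  · exact (integrable_gaussian (half_pos (scale_pos hk _))).const_mul _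

lemma integral_density_pos (ha : 0 < a) {c₀ : ℝ} (hbdd : ∀ x, c₀ ≤ V x) (hV : Continuous V) :
    0 < ∫ x, Real.exp (-pot a b V x) := by
  have hi : Integrable fun x => Real.exp (-pot a b V x) := by
    have := integrable_mul_density (b := b) (f := fun _ => 1) (C := 1) ha hV hbdd continuous_const
      fun x => by
        have h3 : 0 ≤ a * ‖x‖ ^ 2 := by positivity
        rw [abs_one]; nlinarith
    simpa using this
  exact integral_exp_pos hi

/-- The smoothed ball measure is log-concave in the logarithmic radius. -/
lemma flow_logConcave (hk : 0 < k) (hV : ContDiff ℝ ∞ V) (heven : ∀ x, V (-x) = V x)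
    (hconv : ∀ x (v : Fin n → ℝ), 0 ≤ ∑ i, ∑ j, pd i (pd j V) x * v i * v j)
    {c₀ : ℝ} (hbdd : ∀ x, c₀ ≤ V x) {s t lam : ℝ} (h0 : 0 ≤ lam) (h1 : lam ≤ 1) :
    (∫ x, Real.exp (-pot (scale k s) b V x)) ^ (1 - lam) *
      (∫ x, Real.exp (-pot (scale k t) b V x)) ^ lam ≤
      ∫ x, Real.exp (-pot (scale k ((1 - lam) * s + lam * t)) b V x) := by
  have hc := hV.continuous
  set G : ℝ → ℝ := fun t => ∫ x, Real.exp (-pot (scale k t) b V x) with hG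
  set M : ℝ → ℝ := fun t => ∫ x, -hfun (scale k t) b x * Real.exp (-pot (scale k t) b V x) with hM
  set N : ℝ → ℝ := fun t => ∫ x, (hfun (scale k t) b x ^ 2 - qfun (scale k t) b x) *
    Real.exp (-pot (scale k t) b V x) with hN
  have one_le : ∀ t (x : Euc n), (1 : ℝ) ≤ (1 + scale k t * ‖x‖ ^ 2) ^ 2 := fun t x =>
    one_le_pow₀ (by have := scale_pos hk t; nlinarith [sq_nonneg ‖x‖])
  have hGpos : ∀ t, 0 < G t := fun t => integral_density_pos (scale_pos hk t) hbdd hc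
  have hGd : ∀ t, HasDerivAt G (M t) t := by
    intro t
    have := hasDerivAt_integral_flow (b := b) (g := fun _ _ => 1) (C := 2) hk hbdd hc
      (fun t => continuous_const) (fun t => contDiff_hfun.continuous.neg)
      (fun t x => by have := one_le t x; rw [abs_one]; linarith)
      (fun t x => abs_hfun_le (b := b) (scale_pos hk t) x)
      (fun t x => by simpa using hasDerivAt_density t x) t
    simp only [one_mul] at this
    exact this
  have hMd : ∀ t, HasDerivAt M (N t) t := by
    intro t
    refine hasDerivAt_integral_flow (b := b) (C := 8) hk hbdd hc
      (fun t => contDiff_hfun.continuous.neg)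
      (fun t => (contDiff_hfun.continuous.pow 2).sub contDiff_qfun.continuous)
      (fun t x => ?_) (fun t x => abs_hfun_sq_sub_le (scale_pos hk t) x)
      (fun t x => hasDerivAt_hfun_density t x) t
    refine (abs_hfun_le (scale_pos hk t) x).trans ?_
    have := one_le t x
    linarith
  have hNM : ∀ t, N t * G t ≤ M t ^ 2 := by
    intro t
    have ha := scale_pos hk t
    have iG : Integrable fun x => Real.exp (-pot (scale k t) b V x) := by
      by_contra h
      have h2 := hGpos t
      simp only [hG] at h2
      rw [integral_undef h] at h2
      exact lt_irrefl _ h2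
    have iM := integrable_mul_density (b := b) ha hc hbdd contDiff_hfun.continuous.neg
      (abs_hfun_le (b := b) ha)
    have iN := integrable_mul_density (b := b) ha hc hbdd
      ((contDiff_hfun.continuous.pow 2).sub contDiff_qfun.continuous)
      (abs_hfun_sq_sub_le (b := b) ha)
    have e1 : ∀ m : ℝ, ∫ x, (hfun (scale k t) b x - m) * Real.exp (-pot (scale k t) b V x) =
        -M t - m * G t := by
      intro m
      refine Eq.trans ?_ ((integral_lin iN iM iG 0 (-1) (-m)).trans ?_)
      · congr 1; ext x; simp only [Pi.neg_apply]; ring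
      · change 0 * N t + -1 * M t + -m * G t = _; ring
    have e2 : ∀ m : ℝ, ∫ x, (qfun (scale k t) b x - (hfun (scale k t) b x - m) ^ 2) *
        Real.exp (-pot (scale k t) b V x) = -N t - 2 * m * M t - m ^ 2 * G t := by
      intro m
      refine Eq.trans ?_ ((integral_lin iN iM iG (-1) (-2 * m) (-m ^ 2)).trans ?_)
      · congr 1; ext x; simp only [Pi.sub_apply, Pi.neg_apply, Pi.pow_apply]; ring
      · change -1 * N t + -2 * m * M t + -m ^ 2 * G t = _; ring
    have hg := hGpos t
    have hv := variance_le (b := b) ha hV heven hconv hbdd (m := -M t / G t)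
      (by rw [e1]; field_simp; ring)
    rw [e2] at hv
    have h3 : -N t - 2 * (-M t / G t) * M t - (-M t / G t) ^ 2 * G t =
      (M t ^ 2 - N t * G t) / G t := by field_simp; ring
    rw [h3] at hv
    have := (le_div_iff₀ hg).1 hv
    linarith
  have hlog : ∀ t, HasDerivAt (fun t => Real.log (G t)) (M t / G t) t := fun t =>
    (hGd t).log (hGpos t).ne'
  have hlog' : deriv (fun t => Real.log (G t)) = fun t => M t / G t := funext fun t =>
    (hlog t).deriv
  have hlog2 : ∀ t, HasDerivAt (fun t => M t / G t)
      ((N t * G t - M t * M t) / G t ^ 2) t := fun t => (hMd t).div (hGd t) (hGpos t).ne'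
  have hcv : ConcaveOn ℝ univ fun t => Real.log (G t) := by
    refine concaveOn_univ_of_deriv2_nonpos (fun t => (hlog t).differentiableAt) ?_ ?_
    · rw [hlog']; exact fun t => (hlog2 t).differentiableAt
    · intro t
      simp only [Function.iterate_succ, Function.iterate_zero, Function.comp_apply, id]
      rw [hlog', (hlog2 t).deriv]
      exact div_nonpos_of_nonpos_of_nonneg (by have := hNM t; nlinarith) (sq_nonneg _)
  have hfin := hcv.2 (mem_univ s) (mem_univ t) (sub_nonneg.2 h1) h0 (by ring)
  simp only [smul_eq_mul] at hfin
  change G s ^ (1 - lam) * G t ^ lam ≤ G ((1 - lam) * s + lam * t)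
  rw [Real.rpow_def_of_pos (hGpos s), Real.rpow_def_of_pos (hGpos t), ← Real.exp_add,
    ← Real.le_log_iff_exp_le (hGpos _)]
  linarith

end Flow

end Dilation

section Smooth

variable {V : Euc n → ℝ}

lemma fderiv_apply_eq_sum (f : Euc n → ℝ) (x v : Euc n) :
    fderiv ℝ f x v = ∑ i, v i * pd i f x := by
  conv_lhs => rw [← (EuclideanSpace.basisFun (Fin n) ℝ).sum_repr v]
  simp [pd]

lemma hasDerivAt_line {f : Euc n → ℝ} (hf : ContDiff ℝ ∞ f) (x v : Euc n) (s : ℝ) :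
    HasDerivAt (fun s : ℝ => f (x + s • v)) (∑ i, v i * pd i f (x + s • v)) s := by
  rw [← fderiv_apply_eq_sum]
  have h : HasDerivAt (fun s : ℝ => x + s • v) v s := by
    simpa using ((hasDerivAt_id s).smul_const v).const_add x
  exact (differentiable_of_smooth hf _).hasFDerivAt.comp_hasDerivAt s h

/-- The Hessian of a smooth convex function is positive semidefinite. -/
lemma hessian_nonneg (hV : ContDiff ℝ ∞ V) (hc : ConvexOn ℝ univ V) (x : Euc n) (v : Fin n → ℝ) :
    0 ≤ ∑ i, ∑ j, pd i (pd j V) x * v i * v j := by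
  set y : Euc n := WithLp.toLp 2 v with hy
  have hg : ConvexOn ℝ univ fun s : ℝ => V (x + s • y) := by
    refine ⟨convex_univ, fun s _ t _ p q hp hq hpq => ?_⟩
    have := hc.2 (mem_univ (x + s • y)) (mem_univ (x + t • y)) hp hq hpq
    refine le_trans (le_of_eq ?_) this
    have e : x = p • x + q • x := by rw [← add_smul, hpq, one_smul]
    change V (x + (p * s + q * t) • y) = V _
    congr 1
    nth_rewrite 1 [e]
    simp only [add_smul, smul_add, mul_smul]
    abel
  have hd := hasDerivAt_line hV x y
  have hm : Monotone fun s : ℝ => ∑ i, y i * pd i V (x + s • y) := by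
    have := hg.monotoneOn_deriv fun s _ => (hd s).differentiableAt
    intro s t hst
    have h := this (mem_univ s) (mem_univ t) hst
    rwa [(hd s).deriv, (hd t).deriv] at h
  have h2 := hm.deriv_nonneg (x := 0)
  have hd2 : HasDerivAt (fun s : ℝ => ∑ i, y i * pd i V (x + s • y))
      (∑ j, y j * ∑ i, y i * pd i (pd j V) (x + (0 : ℝ) • y)) 0 :=
    HasDerivAt.fun_sum fun j _ => (hasDerivAt_line (contDiff_pd hV j) x y 0).const_mul (y j)
  rw [hd2.deriv] at h2
  refine h2.trans (le_of_eq ?_)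
  rw [Finset.sum_comm]
  refine Finset.sum_congr rfl fun j _ => ?_
  rw [Finset.mul_sum]
  refine Finset.sum_congr rfl fun i _ => ?_
  simp only [zero_smul, add_zero, hy]
  ring

lemma exp_neg_pot (k t : ℝ) (x : Euc n) : Real.exp (-pot (scale k t) (-k) V x) =
    1 / (1 + Real.exp (k * (Real.exp (2 * t) * ‖x‖ ^ 2 - 1))) * Real.exp (-V x) := by
  rw [pot, neg_add, Real.exp_add, exp_neg_fW, scale]
  ring_nf

lemma tendsto_fermi_zero {y : ℝ} (hy : 0 < y) :
    Tendsto (fun k : ℕ => 1 / (1 + Real.exp (((k : ℝ) + 1) * y))) atTop (𝓝 0) := by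
  simp_rw [one_div]
  refine tendsto_inv_atTop_zero.comp (tendsto_atTop_add_const_left _ _
    (Real.tendsto_exp_atTop.comp (Tendsto.atTop_mul_const hy ?_)))
  exact tendsto_atTop_add_const_right _ _ tendsto_natCast_atTop_atTop

lemma tendsto_fermi_one {y : ℝ} (hy : y < 0) :
    Tendsto (fun k : ℕ => 1 / (1 + Real.exp (((k : ℝ) + 1) * y))) atTop (𝓝 1) := by
  have h : Tendsto (fun k : ℕ => Real.exp (((k : ℝ) + 1) * y)) atTop (𝓝 0) :=
    Real.tendsto_exp_atBot.comp (Tendsto.atTop_mul_const_of_neg hy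
      (tendsto_atTop_add_const_right _ _ tendsto_natCast_atTop_atTop))
  simpa using (h.const_add 1).inv₀ (by norm_num)

lemma fermi_le {k : ℝ} (hk : 1 ≤ k) (y : ℝ) : 1 / (1 + Real.exp (k * y)) ≤ Real.exp (-y) := by
  rw [div_le_iff₀ (one_add_exp_pos _), mul_add, mul_one, ← Real.exp_add]
  rcases le_total 0 y with h | h
  · have h1 := Real.one_le_exp (x := -y + k * y) (by nlinarith)
    have h2 := Real.exp_pos (-y)
    linarith
  · have h1 := Real.one_le_exp (x := -y) (by linarith)
    have h2 := Real.exp_pos (-y + k * y)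
    linarith

lemma exp_two_mul_norm_sq (t : ℝ) (x : Euc n) :
    Real.exp (2 * -t) * ‖x‖ ^ 2 = (‖x‖ / Real.exp t) ^ 2 := by
  rw [div_pow, div_eq_mul_inv, ← Real.exp_nat_mul, ← Real.exp_neg]
  push_cast
  ring_nf

lemma tendsto_flow (hV : Continuous V) {c₀ : ℝ} (hbdd : ∀ x, c₀ ≤ V x) (t : ℝ) :
    Tendsto (fun k : ℕ => ∫ x, Real.exp (-pot (scale ((k : ℝ) + 1) (-t)) (-((k : ℝ) + 1)) V x))
      atTop (𝓝 (∫ x in Metric.closedBall (0 : Euc n) (Real.exp t), Real.exp (-V x))) := by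
  rw [← integral_indicator measurableSet_closedBall]
  refine tendsto_integral_of_dominated_convergence
    (fun x => Real.exp 1 * Real.exp (-Real.exp (2 * -t) * ‖x‖ ^ 2) * Real.exp (-c₀))
    (fun k => (continuous_pot hV).neg.rexp.aestronglyMeasurable)
    (((integrable_gaussian (Real.exp_pos _)).const_mul _).mul_const _)
    (fun k => Eventually.of_forall fun x => ?_) ?_
  · rw [Real.norm_of_nonneg (Real.exp_pos _).le, exp_neg_pot]
    refine mul_le_mul ?_ (Real.exp_le_exp.2 (neg_le_neg (hbdd x))) (Real.exp_pos _).le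
      (by positivity)
    refine (fermi_le (by have := Nat.cast_nonneg (α := ℝ) k; linarith) _).trans (le_of_eq ?_)
    rw [← Real.exp_add]
    ring_nf
  · have hs : ∀ᵐ x : Euc n, x ∉ Metric.sphere (0 : Euc n) (Real.exp t) :=
      measure_eq_zero_iff_ae_notMem.1
        (Measure.addHaar_sphere_of_ne_zero _ _ (Real.exp_pos t).ne')
    filter_upwards [hs] with x hx
    simp_rw [exp_neg_pot, exp_two_mul_norm_sq]
    rw [mem_sphere_zero_iff_norm] at hx
    have he := Real.exp_pos t
    rcases lt_or_gt_of_ne hx with h | h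
    · rw [indicator_of_mem (by simpa using h.le)]
      have h1 : ‖x‖ / Real.exp t < 1 := (div_lt_one he).2 h
      have h2 : (‖x‖ / Real.exp t) ^ 2 - 1 < 0 :=
        sub_neg.2 (pow_lt_one₀ (by positivity) h1 two_ne_zero)
      simpa using (tendsto_fermi_one h2).mul_const (Real.exp (-V x))
    · rw [indicator_of_notMem (by simpa using h)]
      have h1 : 1 < ‖x‖ / Real.exp t := (one_lt_div he).2 h
      have h2 : 0 < (‖x‖ / Real.exp t) ^ 2 - 1 := sub_pos.2 (one_lt_pow₀ h1 two_ne_zero)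
      simpa using (tendsto_fermi_zero h2).mul_const (Real.exp (-V x))

/-- The inequality for smooth potentials. -/
lemma ball_logConcave_of_smooth (hV : ContDiff ℝ ∞ V) (heven : ∀ x, V (-x) = V x)
    (hc : ConvexOn ℝ univ V) {c₀ : ℝ} (hbdd : ∀ x, c₀ ≤ V x) {s t lam : ℝ} (h0 : 0 ≤ lam)
    (h1 : lam ≤ 1) :
    (∫ x in Metric.closedBall (0 : Euc n) (Real.exp s), Real.exp (-V x)) ^ (1 - lam) *
      (∫ x in Metric.closedBall (0 : Euc n) (Real.exp t), Real.exp (-V x)) ^ lam ≤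
      ∫ x in Metric.closedBall (0 : Euc n) (Real.exp ((1 - lam) * s + lam * t)),
        Real.exp (-V x) := by
  have hlim := tendsto_flow hV.continuous hbdd
  refine le_of_tendsto_of_tendsto (((hlim s).rpow_const (Or.inr (sub_nonneg.2 h1))).mul
    ((hlim t).rpow_const (Or.inr h0))) (hlim _) (Eventually.of_forall fun k => ?_)
  have := flow_logConcave (k := (k : ℝ) + 1) (b := -((k : ℝ) + 1)) (s := -s) (t := -t)
    (by positivity) hV heven (hessian_nonneg hV hc) hbdd h0 h1
  refine this.trans (le_of_eq ?_)
  rw [show (1 - lam) * -s + lam * -t = -((1 - lam) * s + lam * t) by ring]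

end Smooth

section Approximation

variable {V : Euc n → ℝ} {c : ℝ}

/-- `t ↦ ∫ g` over the centred ball of radius `exp t` is log-concave. -/
def BallIntegralLogConcave (g : Euc n → ℝ) : Prop :=
  ∀ s t lam : ℝ, 0 ≤ lam → lam ≤ 1 →
    (∫ x in Metric.closedBall (0 : Euc n) (Real.exp s), g x) ^ (1 - lam) *
      (∫ x in Metric.closedBall (0 : Euc n) (Real.exp t), g x) ^ lam ≤
      ∫ x in Metric.closedBall (0 : Euc n) (Real.exp ((1 - lam) * s + lam * t)), g x

lemma BallIntegralLogConcave.of_tendsto {F : ℕ → Euc n → ℝ} {g : Euc n → ℝ}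
    (hF : ∀ k, Continuous (F k)) (hc : ∀ k x, c ≤ F k x)
    (h : ∀ k, BallIntegralLogConcave fun x => Real.exp (-F k x))
    (hlim : ∀ᵐ x, Tendsto (fun k => Real.exp (-F k x)) atTop (𝓝 (g x))) :
    BallIntegralLogConcave g := by
  intro s t lam h0 h1
  have hl : ∀ r : ℝ, Tendsto (fun k => ∫ x in Metric.closedBall (0 : Euc n) r, Real.exp (-F k x))
      atTop (𝓝 (∫ x in Metric.closedBall (0 : Euc n) r, g x)) := fun r => by
    have : IsFiniteMeasure (volume.restrict (Metric.closedBall (0 : Euc n) r)) :=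
      isFiniteMeasure_restrict.2 (isCompact_closedBall _ _).measure_lt_top.ne
    refine tendsto_integral_of_dominated_convergence (fun _ => Real.exp (-c))
      (fun k => (hF k).neg.rexp.aestronglyMeasurable) (integrable_const _)
      (fun k => Eventually.of_forall fun x => ?_) (ae_restrict_of_ae hlim)
    rw [Real.norm_of_nonneg (Real.exp_pos _).le]
    exact Real.exp_le_exp.2 (neg_le_neg (hc k x))
  exact le_of_tendsto_of_tendsto (((hl _).rpow_const (Or.inr (sub_nonneg.2 h1))).mul
    ((hl _).rpow_const (Or.inr h0))) (hl _) (Eventually.of_forall fun k => h k s t lam h0 h1)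

lemma conv_moll_eq (V : Euc n → ℝ) (k : ℕ) (x : Euc n) :
    conv (moll n k) V x = ∫ t, V (x - t) * moll n k t := by
  rw [conv_apply, ← integral_sub_left_eq_self (fun t => V t * moll n k (x - t)) volume x]
  simp

lemma integrable_comp_sub_mul_moll (hV : Continuous V) (k : ℕ) (x : Euc n) :
    Integrable fun t => V (x - t) * moll n k t := by
  have := (integrable_conv_integrand hV.locallyIntegrable (contDiff_moll k).continuous
    (hasCompactSupport_moll k) x).comp_sub_left x
  simpa using this

lemma conv_moll_neg (heven : ∀ x, V (-x) = V x) (k : ℕ) (x : Euc n) :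
    conv (moll n k) V (-x) = conv (moll n k) V x := by
  rw [conv_apply, conv_apply, ← integral_neg_eq_self]
  congr 1 with t
  rw [heven, ← moll_neg]
  congr 2
  abel

lemma le_conv_moll (hV : Continuous V) (hc : ∀ x, c ≤ V x) (k : ℕ) (x : Euc n) :
    c ≤ conv (moll n k) V x := by
  rw [conv_moll_eq]
  calc c = ∫ t, c * moll n k t := by rw [integral_const_mul, integral_moll, mul_one]
    _ ≤ _ := integral_mono ((integrable_moll n k).const_mul c)
        (integrable_comp_sub_mul_moll hV k x)
        fun t => mul_le_mul_of_nonneg_right (hc _) (moll_nonneg k t)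

lemma convexOn_conv_moll (hV : Continuous V) (hconv : ConvexOn ℝ univ V) (k : ℕ) :
    ConvexOn ℝ univ (conv (moll n k) V) := by
  refine ⟨convex_univ, fun x _ y _ a b ha hb hab => ?_⟩
  have hx := integrable_comp_sub_mul_moll hV k x
  have hy := integrable_comp_sub_mul_moll hV k y
  rw [conv_moll_eq, conv_moll_eq, conv_moll_eq, smul_eq_mul, smul_eq_mul,
    ← integral_const_mul, ← integral_const_mul,
    ← integral_add (hx.const_mul a) (hy.const_mul b)]
  refine integral_mono (integrable_comp_sub_mul_moll hV k _)
    ((hx.const_mul a).add (hy.const_mul b)) fun t => ?_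
  have h := hconv.2 (mem_univ (x - t)) (mem_univ (y - t)) ha hb hab
  have he : a • x + b • y - t = a • (x - t) + b • (y - t) := by
    rw [smul_sub, smul_sub, sub_add_sub_comm, ← add_smul, hab, one_smul]
  simp only [smul_eq_mul] at h
  simp only [he, ← mul_assoc, ← add_mul]
  exact mul_le_mul_of_nonneg_right h (moll_nonneg k t)

lemma ballIntegralLogConcave_of_continuous (hV : Continuous V) (heven : ∀ x, V (-x) = V x)
    (hconv : ConvexOn ℝ univ V) (hc : ∀ x, c ≤ V x) :
    BallIntegralLogConcave fun x => Real.exp (-V x) := by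
  have hs : ∀ k, ContDiff ℝ ∞ (conv (moll n k) V) := fun k =>
    contDiff_conv hV.locallyIntegrable (contDiff_moll k) (hasCompactSupport_moll k)
  refine .of_tendsto (fun k => (hs k).continuous) (le_conv_moll hV hc)
    (fun k s t lam h0 h1 => ball_logConcave_of_smooth (hs k) (conv_moll_neg heven k)
      (convexOn_conv_moll hV hconv k) (le_conv_moll hV hc k) h0 h1)
    (Eventually.of_forall fun x => ?_)
  exact (Real.continuous_exp.tendsto _).comp (tendsto_conv_of_continuous hV x).neg

/-- Lipschitz regularisation of a function `v` on `D`. -/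
noncomputable def lipReg (D : Set (Euc n)) (v : Euc n → ℝ) (m : ℕ) (x : Euc n) : ℝ :=
  ⨅ y : D, (v y + m * ‖x - y‖)

variable {D : Set (Euc n)} {v : Euc n → ℝ}

lemma bddBelow_lipReg (hc : ∀ x ∈ D, c ≤ v x) (m : ℕ) (x : Euc n) :
    BddBelow (range fun y : D => v y + m * ‖x - y‖) :=
  ⟨c, by rintro _ ⟨y, rfl⟩; exact (hc y y.2).trans (le_add_of_nonneg_right (by positivity))⟩

lemma lipReg_le (hc : ∀ x ∈ D, c ≤ v x) (m : ℕ) (x : Euc n) {y : Euc n} (hy : y ∈ D) :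
    lipReg D v m x ≤ v y + m * ‖x - y‖ :=
  ciInf_le (bddBelow_lipReg hc m x) ⟨y, hy⟩

lemma le_lipReg (hD : D.Nonempty) {m : ℕ} {x : Euc n} {d : ℝ}
    (h : ∀ y ∈ D, d ≤ v y + m * ‖x - y‖) : d ≤ lipReg D v m x :=
  have := hD.to_subtype
  le_ciInf fun y => h y y.2

lemma const_le_lipReg (hD : D.Nonempty) (hc : ∀ x ∈ D, c ≤ v x) (m : ℕ) (x : Euc n) :
    c ≤ lipReg D v m x :=
  le_lipReg hD fun y hy => (hc y hy).trans (le_add_of_nonneg_right (by positivity))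

lemma continuous_lipReg (hD : D.Nonempty) (hc : ∀ x ∈ D, c ≤ v x) (m : ℕ) :
    Continuous (lipReg D v m) := by
  refine (LipschitzWith.of_le_add_mul (m : NNReal) fun x z => ?_).continuous
  rw [← sub_le_iff_le_add]
  refine le_lipReg hD fun y hy => ?_
  have h1 := lipReg_le hc m x hy
  have h2 : (m : ℝ) * ‖x - y‖ ≤ m * (dist x z + ‖z - y‖) := by
    gcongr
    rw [dist_eq_norm]
    exact norm_sub_le_norm_sub_add_norm_sub x z y
  rw [NNReal.coe_natCast]
  linarith

lemma lipReg_neg (hD : D.Nonempty) (hc : ∀ x ∈ D, c ≤ v x)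
    (heven : ∀ x ∈ D, -x ∈ D ∧ v (-x) = v x) (m : ℕ) (x : Euc n) :
    lipReg D v m (-x) = lipReg D v m x := by
  have key : ∀ z, lipReg D v m (-z) ≤ lipReg D v m z := fun z => le_lipReg hD fun y hy => by
    have h := lipReg_le hc m (-z) (heven y hy).1
    rwa [(heven y hy).2, ← neg_sub', norm_neg] at h
  exact (key x).antisymm (by simpa using key (-x))

lemma convexOn_lipReg (hD : D.Nonempty) (hv : ConvexOn ℝ D v) (hc : ∀ x ∈ D, c ≤ v x) (m : ℕ) :
    ConvexOn ℝ univ (lipReg D v m) := by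
  have := hD.to_subtype
  refine ⟨convex_univ, fun x _ z _ a b ha hb hab => ?_⟩
  refine le_of_forall_pos_le_add fun ε hε => ?_
  obtain ⟨⟨y, hy⟩, h1⟩ := exists_lt_of_ciInf_lt (lt_add_of_pos_right (lipReg D v m x) hε)
  obtain ⟨⟨w, hw⟩, h2⟩ := exists_lt_of_ciInf_lt (lt_add_of_pos_right (lipReg D v m z) hε)
  have h3 := lipReg_le hc m (a • x + b • z) (hv.1 hy hw ha hb hab)
  have h4 := hv.2 hy hw ha hb hab
  have h5 : ‖a • x + b • z - (a • y + b • w)‖ ≤ a * ‖x - y‖ + b * ‖z - w‖ := by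
    rw [add_sub_add_comm, ← smul_sub, ← smul_sub]
    refine (norm_add_le _ _).trans_eq ?_
    rw [norm_smul, norm_smul, Real.norm_of_nonneg ha, Real.norm_of_nonneg hb]
  have h6 := mul_le_mul_of_nonneg_left h5 (Nat.cast_nonneg (α := ℝ) m)
  have h7 := mul_le_mul_of_nonneg_left h1.le ha
  have h8 := mul_le_mul_of_nonneg_left h2.le hb
  have h9 : ε = a * ε + b * ε := by rw [← add_mul, hab, one_mul]
  simp only [smul_eq_mul] at h4 ⊢
  linarith

lemma eventually_le_const_add_mul (c d : ℝ) {δ : ℝ} (hδ : 0 < δ) :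
    ∀ᶠ m : ℕ in atTop, d ≤ c + m * δ :=
  (tendsto_atTop_add_const_left _ c
    (tendsto_natCast_atTop_atTop.atTop_mul_const hδ)).eventually_ge_atTop d

lemma tendsto_lipReg_of_mem_interior (hv : ConvexOn ℝ D v) (hc : ∀ x ∈ D, c ≤ v x) {x : Euc n}
    (hx : x ∈ interior D) : Tendsto (fun m => lipReg D v m x) atTop (𝓝 (v x)) := by
  have hxD := interior_subset hx
  refine tendsto_order.2 ⟨fun d hd => ?_, fun d hd => Eventually.of_forall fun m => ?_⟩
  · obtain ⟨e, hde, hev⟩ := exists_between hd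
    have hcont : ContinuousAt v x :=
      hv.continuousOn_interior.continuousAt (isOpen_interior.mem_nhds hx)
    obtain ⟨δ, hδ, hball⟩ := Metric.eventually_nhds_iff.1 (hcont.eventually_const_lt hev)
    filter_upwards [eventually_le_const_add_mul c e hδ] with m hm
    refine hde.trans_le (le_lipReg ⟨x, hxD⟩ fun y hy => ?_)
    by_cases h : dist y x < δ
    · exact (hball h).le.trans (le_add_of_nonneg_right (by positivity))
    · rw [dist_comm, dist_eq_norm, not_lt] at h
      have := hc y hy
      have := mul_le_mul_of_nonneg_left h (Nat.cast_nonneg (α := ℝ) m)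
      linarith
  · have := lipReg_le hc m x hxD
    simp only [sub_self, norm_zero, mul_zero, add_zero] at this
    exact this.trans_lt hd

lemma tendsto_lipReg_of_notMem_closure (hD : D.Nonempty) (hc : ∀ x ∈ D, c ≤ v x) {x : Euc n}
    (hx : x ∉ closure D) : Tendsto (fun m => lipReg D v m x) atTop atTop := by
  obtain ⟨δ, hδ, hball⟩ : ∃ δ > 0, ∀ y ∈ D, δ ≤ dist x y := by
    simpa [Metric.mem_closure_iff] using hx
  refine tendsto_atTop.2 fun d => ?_
  filter_upwards [eventually_le_const_add_mul c d hδ] with m hm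
  refine hm.trans (le_lipReg hD fun y hy => add_le_add (hc y hy) ?_)
  rw [← dist_eq_norm]
  exact mul_le_mul_of_nonneg_left (hball y hy) (Nat.cast_nonneg _)

lemma ae_tendsto_exp_neg_lipReg (hD : D.Nonempty) (hv : ConvexOn ℝ D v) (hc : ∀ x ∈ D, c ≤ v x) :
    ∀ᵐ x, Tendsto (fun m => Real.exp (-lipReg D v m x)) atTop
      (𝓝 (D.indicator (fun x => Real.exp (-v x)) x)) := by
  filter_upwards [measure_eq_zero_iff_ae_notMem.1 (hv.1.addHaar_frontier volume)] with x hx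
  by_cases h : x ∈ interior D
  · rw [indicator_of_mem (interior_subset h)]
    exact (Real.continuous_exp.tendsto _).comp (tendsto_lipReg_of_mem_interior hv hc h).neg
  · have h' : x ∉ closure D := fun h' => hx ⟨h', h⟩
    rw [indicator_of_notMem fun hxD => h' (subset_closure hxD)]
    exact Real.tendsto_exp_neg_atTop_nhds_zero.comp (tendsto_lipReg_of_notMem_closure hD hc h')

/-- The inequality for an even convex potential with arbitrary domain. -/
lemma ballIntegralLogConcave_indicator (hD : D.Nonempty) (hv : ConvexOn ℝ D v)
    (heven : ∀ x ∈ D, -x ∈ D ∧ v (-x) = v x) (hc : ∀ x ∈ D, c ≤ v x) :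
    BallIntegralLogConcave (D.indicator fun x => Real.exp (-v x)) :=
  .of_tendsto (continuous_lipReg hD hc) (const_le_lipReg hD hc)
    (fun m => ballIntegralLogConcave_of_continuous (continuous_lipReg hD hc m)
      (lipReg_neg hD hc heven m) (convexOn_lipReg hD hv hc m) (const_le_lipReg hD hc m))
    (ae_tendsto_exp_neg_lipReg hD hv hc)

lemma integrableOn_closedBall_indicator (hD : D.Nonempty) (hv : ConvexOn ℝ D v)
    (hc : ∀ x ∈ D, c ≤ v x) (r : ℝ) :
    IntegrableOn (D.indicator fun x => Real.exp (-v x)) (Metric.closedBall 0 r) := by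
  have : IsFiniteMeasure (volume.restrict (Metric.closedBall (0 : Euc n) r)) :=
    isFiniteMeasure_restrict.2 (isCompact_closedBall _ _).measure_lt_top.ne
  have hm : AEStronglyMeasurable (D.indicator fun x => Real.exp (-v x)) volume :=
    aestronglyMeasurable_of_tendsto_ae atTop
      (fun m => (continuous_lipReg hD hc m).neg.rexp.aestronglyMeasurable)
      (ae_tendsto_exp_neg_lipReg hD hv hc)
  refine Integrable.of_bound hm.restrict (Real.exp (-c)) (Eventually.of_forall fun x => ?_)
  by_cases hx : x ∈ D
  · rw [indicator_of_mem hx, Real.norm_of_nonneg (Real.exp_pos _).le]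
    exact Real.exp_le_exp.2 (neg_le_neg (hc x hx))
  · rw [indicator_of_notMem hx, norm_zero]
    exact (Real.exp_pos _).le

end Approximation

lemma lintegral_ball_logConcave {V : Euc n → EReal} (hbot : ∀ x, V x ≠ ⊥)
    (heven : ∀ x, V (-x) = V x)
    (hconv : ∀ x y : Euc n, ∀ a b : ℝ, 0 ≤ a → 0 ≤ b → a + b = 1 →
      V (a • x + b • y) ≤ (a : EReal) * V x + (b : EReal) * V y)
    {s t lam : ℝ} (h0 : 0 ≤ lam) (h1 : lam ≤ 1) :
    (∫⁻ x in Metric.closedBall (0 : Euc n) (Real.exp s), EReal.exp (-V x)) ^ (1 - lam) *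
      (∫⁻ x in Metric.closedBall (0 : Euc n) (Real.exp t), EReal.exp (-V x)) ^ lam ≤
      ∫⁻ x in Metric.closedBall (0 : Euc n) (Real.exp ((1 - lam) * s + lam * t)),
        EReal.exp (-V x) := by
  set D : Set (Euc n) := {x | V x ≠ ⊤}
  set v : Euc n → ℝ := fun x => (V x).toReal
  have hcoe : ∀ x ∈ D, V x = (v x : EReal) := fun x hx => (EReal.coe_toReal hx (hbot x)).symm
  have hsegment : ∀ x ∈ D, ∀ y ∈ D, ∀ a b : ℝ, 0 ≤ a → 0 ≤ b → a + b = 1 →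
      V (a • x + b • y) ≤ ((a * v x + b * v y : ℝ) : EReal) := fun x hx y hy a b ha hb hab => by
    refine (hconv x y a b ha hb hab).trans_eq ?_
    rw [hcoe x hx, hcoe y hy]
    norm_cast
  have hDconv : Convex ℝ D := fun x hx y hy a b ha hb hab =>
    ((hsegment x hx y hy a b ha hb hab).trans_lt (EReal.coe_lt_top _)).ne
  have hv : ConvexOn ℝ D v := ⟨hDconv, fun x hx y hy a b ha hb hab => by
    have h := hsegment x hx y hy a b ha hb hab
    rw [hcoe _ (hDconv hx hy ha hb hab)] at h
    exact_mod_cast h⟩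
  have hev : ∀ x ∈ D, -x ∈ D ∧ v (-x) = v x := fun x hx => by
    have hx' : V (-x) ≠ ⊤ := by rwa [heven]
    exact ⟨hx', by simp only [v, heven]⟩
  rcases D.eq_empty_or_nonempty with hD | hD
  · have htop : ∀ x, V x = ⊤ := fun x => by
      by_contra hx
      exact (hD ▸ (show x ∈ D from hx) : x ∈ (∅ : Set (Euc n)))
    rcases h0.eq_or_lt with rfl | h0
    · simp [htop]
    · simp [htop, h0]
  have hc : ∀ x ∈ D, v 0 ≤ v x := fun x hx => by
    have h := hv.2 hx (hev x hx).1 (by norm_num) (by norm_num)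
      (by norm_num : (1 / 2 : ℝ) + 1 / 2 = 1)
    rw [(hev x hx).2, smul_neg, add_neg_cancel, smul_eq_mul] at h
    linarith
  set g : Euc n → ℝ := D.indicator fun x => Real.exp (-v x)
  have hg : ∀ x, 0 ≤ g x := indicator_nonneg fun x _ => (Real.exp_pos _).le
  have hexp : ∀ x, EReal.exp (-V x) = ENNReal.ofReal (g x) := fun x => by
    by_cases hx : x ∈ D
    · rw [hcoe x hx, ← EReal.coe_neg, EReal.exp_coe, show g x = _ from indicator_of_mem hx _]
    · rw [show g x = _ from indicator_of_notMem hx _, not_not.1 hx]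
      simp
  have hlint : ∀ r : ℝ, ∫⁻ x in Metric.closedBall (0 : Euc n) r, EReal.exp (-V x) =
      ENNReal.ofReal (∫ x in Metric.closedBall (0 : Euc n) r, g x) := fun r => by
    simp only [hexp]
    exact (ofReal_integral_eq_lintegral_ofReal (integrableOn_closedBall_indicator hD hv hc r)
      (Filter.Eventually.of_forall hg)).symm
  have hpos : ∀ r : ℝ, 0 ≤ ∫ x in Metric.closedBall (0 : Euc n) r, g x := fun r =>
    integral_nonneg hg
  rw [hlint, hlint, hlint, ENNReal.ofReal_rpow_of_nonneg (hpos _) (sub_nonneg.2 h1),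
    ENNReal.ofReal_rpow_of_nonneg (hpos _) h0, ← ENNReal.ofReal_mul (Real.rpow_nonneg (hpos _) _)]
  exact ENNReal.ofReal_le_ofReal (ballIntegralLogConcave_indicator hD hv hev hc s t lam h0 h1)

lemma smul_image_closedBall_one (T : Euc n ≃ₗ[ℝ] Euc n) {r : ℝ} (hr : 0 < r) :
    r • (T '' Metric.closedBall (0 : Euc n) 1) = T '' Metric.closedBall (0 : Euc n) r := by
  rw [← image_smul_set, smul_closedBall _ _ zero_le_one]
  simp [abs_of_pos hr]

lemma withDensity_image_closedBall (f : Euc n → ℝ≥0∞) (T : Euc n ≃ₗ[ℝ] Euc n) (r : ℝ) :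
    volume.withDensity f (T '' Metric.closedBall (0 : Euc n) r) =
      ENNReal.ofReal |LinearMap.det (T : Euc n →ₗ[ℝ] Euc n)| *
        ∫⁻ x in Metric.closedBall (0 : Euc n) r, f (T x) := by
  set L := T.toContinuousLinearEquiv
  have hm : MeasurableSet (T '' Metric.closedBall (0 : Euc n) r) :=
    ((isCompact_closedBall _ _).image L.continuous).measurableSet
  rw [withDensity_apply _ hm]
  have h := lintegral_image_eq_lintegral_abs_det_fderiv_mul volume
    (measurableSet_closedBall (x := (0 : Euc n)) (ε := r))
    (fun x _ => (L : Euc n →L[ℝ] Euc n).hasFDerivWithinAt) L.injective.injOn f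
  rw [lintegral_const_mul' _ _ ENNReal.ofReal_ne_top] at h
  exact h

end BallLogConcave

theorem statement2 (n : ℕ) (hn : 1 ≤ n)
    (V : EuclideanSpace ℝ (Fin n) → EReal)
    (hV_bot : ∀ x, V x ≠ ⊥)
    (hV_even : ∀ x, V (-x) = V x)
    (hV_conv : ∀ x y : EuclideanSpace ℝ (Fin n), ∀ a b : ℝ, 0 ≤ a → 0 ≤ b → a + b = 1 →
      V (a • x + b • y) ≤ (a : EReal) * V x + (b : EReal) * V y)
    (ν : Measure (EuclideanSpace ℝ (Fin n)))
    (hν : ν = volume.withDensity (fun x => EReal.exp (-V x)))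
    (T : EuclideanSpace ℝ (Fin n) ≃ₗ[ℝ] EuclideanSpace ℝ (Fin n))
    (E : Set (EuclideanSpace ℝ (Fin n)))
    (hE : E = ⇑T '' Metric.closedBall (0 : EuclideanSpace ℝ (Fin n)) 1) :
    ∀ s t lam : ℝ, 0 ≤ lam → lam ≤ 1 →
      ν (Real.exp s • E) ^ (1 - lam) * ν (Real.exp t • E) ^ lam ≤
        ν (Real.exp ((1 - lam) * s + lam * t) • E) := by
  intro s t lam h0 h1
  subst hν hE
  set C := ENNReal.ofReal
    |LinearMap.det (T : BallLogConcave.Euc n →ₗ[ℝ] BallLogConcave.Euc n)| with hC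
  have hC0 : C ≠ 0 := by
    simpa [hC] using (LinearEquiv.isUnit_det' T).ne_zero
  have hball := BallLogConcave.lintegral_ball_logConcave (V := fun x => V (T x))
    (fun x => hV_bot _) (fun x => by rw [map_neg, hV_even])
    (fun x y a b ha hb hab => by
      rw [map_add, map_smul, map_smul]; exact hV_conv _ _ a b ha hb hab) (s := s) (t := t) h0 h1
  simp only [BallLogConcave.smul_image_closedBall_one T (Real.exp_pos _),
    BallLogConcave.withDensity_image_closedBall, ← hC]
  rw [ENNReal.mul_rpow_of_nonneg _ _ (sub_nonneg.2 h1), ENNReal.mul_rpow_of_nonneg _ _ h0,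
    mul_mul_mul_comm, ← ENNReal.rpow_add _ _ hC0 ENNReal.ofReal_ne_top, sub_add_cancel,
    ENNReal.rpow_one]
  exact mul_le_mul_right hball C
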